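/- arXiv:dg-ga/9712006 — 8 statements merged into one kernel-verified Lean document; each statement's English description precedes it below -/
import Mathlib

section
/- Let n₁, n₂, n₃, n₄ be nonzero vectors in ℝ³ and let Lᵢ = {x ∈ ℝ³ : ⟨nᵢ, x⟩ > 0} be the corresponding open half-spaces, whose boundary planes all pass through the origin. Assume that each of L₂, L₃, L₄ overlaps L₁ (Lᵢ ∩ L₁ ≠ ∅ for i = 2, 3, 4) and that n₁, n₂, n₃ are linearly independent (the boundary planes of L₁, L₂, L₃ are in general position). Then L₁ ∩ (L₂ ∪ L₃ ∪ L₄) is a nonempty, connected, open subset of ℝ³. -/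
open scoped RealInnerProductSpace

section InnerHalfspace

variable {E : Type*} [NormedAddCommGroup E] [InnerProductSpace ℝ E]

theorem LinearIndependent.exists_inner_eq [FiniteDimensional ℝ E] {ι : Type*} {v : ι → E}
    (hv : LinearIndependent ℝ v) (c : ι → ℝ) : ∃ x : E, ∀ i, ⟪v i, x⟫ = c i := by
  obtain ⟨f, hf⟩ := ((Module.Basis.span hv).constr ℝ c).exists_extend
  refine ⟨(InnerProductSpace.toDual ℝ E).symm (LinearMap.toContinuousLinearMap f), fun i => ?_⟩
  rw [real_inner_comm, InnerProductSpace.toDual_symm_apply]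
  have h := LinearMap.congr_fun hf (Module.Basis.span hv i)
  rw [Module.Basis.constr_basis] at h
  simpa [Module.Basis.span_apply] using h

theorem isOpen_inner_pos (n : E) : IsOpen {x : E | 0 < ⟪n, x⟫} :=
  isOpen_lt continuous_const (by fun_prop)

theorem convex_inner_pos (n : E) : Convex ℝ {x : E | 0 < ⟪n, x⟫} :=
  convex_halfSpace_gt (innerₛₗ ℝ n).isLinear 0

/-- Moving a point far along a direction on which `m` is positive makes `m` positive, and
preserves the positivity of functionals that are nonnegative on that direction. -/
theorem exists_inner_pos_of_direction {n k m p v : E} (hn : 0 < ⟪n, p⟫) (hk : 0 < ⟪k, p⟫)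
    (hnv : 0 ≤ ⟪n, v⟫) (hkv : 0 ≤ ⟪k, v⟫) (hmv : ⟪m, v⟫ = 1) :
    ∃ x : E, 0 < ⟪n, x⟫ ∧ 0 < ⟪k, x⟫ ∧ 0 < ⟪m, x⟫ := by
  refine ⟨p + (|⟪m, p⟫| + 1) • v, ?_, ?_, ?_⟩ <;> rw [inner_add_right, real_inner_smul_right]
  · positivity
  · positivity
  · rw [hmv]
    linarith [neg_abs_le ⟪m, p⟫]

end InnerHalfspace

/-- Lemma 8.2 (lem:ints): if the open half-spaces `L₂, L₃, L₄` (bounded by planes through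
the origin) all overlap `L₁` and the boundary planes of `L₁, L₂, L₃` are in general position,
then `L₁ ∩ (L₂ ∪ L₃ ∪ L₄)` is a nonempty connected open subset of `ℝ³`. -/
theorem stmt0 (n₁ n₂ n₃ n₄ : EuclideanSpace ℝ (Fin 3))
    (hn₁ : n₁ ≠ 0) (hn₂ : n₂ ≠ 0) (hn₃ : n₃ ≠ 0) (hn₄ : n₄ ≠ 0)
    (L₁ L₂ L₃ L₄ : Set (EuclideanSpace ℝ (Fin 3)))
    (hL₁ : L₁ = {x | 0 < ⟪n₁, x⟫}) (hL₂ : L₂ = {x | 0 < ⟪n₂, x⟫})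
    (hL₃ : L₃ = {x | 0 < ⟪n₃, x⟫}) (hL₄ : L₄ = {x | 0 < ⟪n₄, x⟫})
    (h21 : (L₂ ∩ L₁).Nonempty) (h31 : (L₃ ∩ L₁).Nonempty) (h41 : (L₄ ∩ L₁).Nonempty)
    (hgen : LinearIndependent ℝ ![n₁, n₂, n₃]) :
    (L₁ ∩ (L₂ ∪ L₃ ∪ L₄)).Nonempty ∧ IsOpen (L₁ ∩ (L₂ ∪ L₃ ∪ L₄)) ∧
      IsConnected (L₁ ∩ (L₂ ∪ L₃ ∪ L₄)) := by
  subst hL₁ hL₂ hL₃ hL₄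
  set H : EuclideanSpace ℝ (Fin 3) → Set (EuclideanSpace ℝ (Fin 3)) := fun n => {x | 0 < ⟪n, x⟫}
  have hconn (n : EuclideanSpace ℝ (Fin 3)) : IsPreconnected (H n₁ ∩ H n) :=
    ((convex_inner_pos n₁).inter (convex_inner_pos n)).isPreconnected
  have hne : (H n₁ ∩ (H n₂ ∪ H n₃ ∪ H n₄)).Nonempty :=
    h21.mono fun x hx => ⟨hx.2, Or.inl (Or.inl hx.1)⟩
  have hopen : IsOpen (H n₁ ∩ (H n₂ ∪ H n₃ ∪ H n₄)) :=
    (isOpen_inner_pos n₁).inter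
      (((isOpen_inner_pos n₂).union (isOpen_inner_pos n₃)).union (isOpen_inner_pos n₄))
  refine ⟨hne, hopen, hne, ?_⟩
  have h23 : IsPreconnected (H n₁ ∩ H n₂ ∪ H n₁ ∩ H n₃) := by
    obtain ⟨x, hx⟩ := hgen.exists_inner_eq ![1, 1, 1]
    simp [Fin.forall_fin_succ] at hx
    refine (hconn n₂).union x ?_ ?_ (hconn n₃) <;> simp [H, hx]
  have hmeet : ∃ x, x ∈ H n₁ ∩ H n₂ ∪ H n₁ ∩ H n₃ ∧ x ∈ H n₁ ∩ H n₄ := by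
    obtain ⟨v, hv⟩ := hgen.exists_inner_eq ![0, 1, -1]
    simp [Fin.forall_fin_succ] at hv
    obtain ⟨hv₁, hv₂, hv₃⟩ := hv
    obtain ⟨p, hp₄, hp₁⟩ := h41
    rcases le_total 0 ⟪n₄, v⟫ with h | h
    · obtain ⟨x, hx₁, hx₄, hx₂⟩ := exists_inner_pos_of_direction hp₁ hp₄ hv₁.ge h hv₂
      exact ⟨x, Or.inl ⟨hx₁, hx₂⟩, hx₁, hx₄⟩
    · obtain ⟨x, hx₁, hx₄, hx₃⟩ := exists_inner_pos_of_direction (m := n₃) (v := -v) hp₁ hp₄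
        (by simp [hv₁]) (by simpa using h) (by simp [hv₃])
      exact ⟨x, Or.inr ⟨hx₁, hx₃⟩, hx₁, hx₄⟩
  obtain ⟨x, hx, hx'⟩ := hmeet
  rw [Set.inter_union_distrib_left, Set.inter_union_distrib_left]
  exact h23.union x hx hx' (hconn n₄)
end

section
/- Let x and y be linearly independent unit vectors in ℝ^{n+1}, and let p = (a x + b y)/‖a x + b y‖ for some reals a, b > 0. For each i ∈ ℕ let λᵢ, νᵢ > 0 and let Aᵢ be a linear automorphism of ℝ^{n+1} with Aᵢ x = λᵢ x and Aᵢ y = νᵢ y, and put ϑᵢ(v) = Aᵢ v/‖Aᵢ v‖. Suppose the sequence ϑᵢ(p) converges to a point q of the unit sphere. Then q lies in the open arc {(c x + d y)/‖c x + d y‖ : c, d > 0} if and only if there is a constant C > 0 with C⁻¹ ≤ λᵢ/νᵢ ≤ C for all i (equivalently, |log(λᵢ/νᵢ)| is bounded). -/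
open Filter

/-- Two linearly independent vectors of a finite-dimensional normed space have continuous
coordinate functionals. -/
lemma exists_dual_pair {E : Type*} [NormedAddCommGroup E] [NormedSpace ℝ E]
    [FiniteDimensional ℝ E] {x y : E} (hxy : LinearIndependent ℝ ![x, y]) :
    ∃ f g : E →L[ℝ] ℝ, f x = 1 ∧ f y = 0 ∧ g x = 0 ∧ g y = 1 := by
  have hinj : LinearMap.ker
      ((LinearMap.toSpanSingleton ℝ E x).coprod (LinearMap.toSpanSingleton ℝ E y)) = ⊥ := by
    rw [LinearMap.ker_eq_bot']
    rintro ⟨s, t⟩ h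
    obtain ⟨rfl, rfl⟩ := LinearIndependent.pair_iff.mp hxy s t (by simpa using h)
    rfl
  obtain ⟨h, hh⟩ := LinearMap.exists_leftInverse_of_injective _ hinj
  have hx : h x = (1, 0) := by simpa using LinearMap.congr_fun hh (1, 0)
  have hy : h y = (0, 1) := by simpa using LinearMap.congr_fun hh (0, 1)
  exact ⟨(LinearMap.fst ℝ ℝ ℝ ∘ₗ h).toContinuousLinearMap,
    (LinearMap.snd ℝ ℝ ℝ ∘ₗ h).toContinuousLinearMap, by simp [hx], by simp [hy],
    by simp [hx], by simp [hy]⟩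

/-- A positive sequence converging to a positive limit is bounded above and away from zero. -/
lemma exists_two_sided_bound_of_tendsto_pos {r : ℕ → ℝ} {L : ℝ} (hr : ∀ i, 0 < r i)
    (hL : 0 < L) (h : Tendsto r atTop (nhds L)) :
    ∃ C : ℝ, 0 < C ∧ ∀ i, C⁻¹ ≤ r i ∧ r i ≤ C := by
  obtain ⟨M, hM⟩ := h.bddAbove_range
  obtain ⟨M', hM'⟩ := (h.inv₀ hL.ne').bddAbove_range
  have hM : ∀ i, r i ≤ M := fun i => hM ⟨i, rfl⟩
  have hM' : ∀ i, (r i)⁻¹ ≤ M' := fun i => hM' ⟨i, rfl⟩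
  refine ⟨max M M', ((hr 0).trans_le (hM 0)).trans_le (le_max_left _ _), fun i => ⟨?_, ?_⟩⟩
  · exact inv_le_of_inv_le₀ (hr i) ((hM' i).trans (le_max_right _ _))
  · exact (hM i).trans (le_max_left _ _)

/-- Lemma 7.2 (lem:eigen), second part: if the sequence `ϑᵢ(p)` converges to a point `q` of
the unit sphere, then `q` lies in the open arc from `x` to `y` if and only if the ratios
`λᵢ/νᵢ` are bounded above and below by positive constants (i.e. `|log(λᵢ/νᵢ)|` is bounded). -/
theorem stmt3 (n : ℕ) (x y : EuclideanSpace ℝ (Fin (n + 1)))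
    (hx : ‖x‖ = 1) (hy : ‖y‖ = 1) (hxy : LinearIndependent ℝ ![x, y])
    (a b : ℝ) (ha : 0 < a) (hb : 0 < b)
    (p : EuclideanSpace ℝ (Fin (n + 1)))
    (hp : p = ‖a • x + b • y‖⁻¹ • (a • x + b • y))
    (lam nu : ℕ → ℝ) (hlam : ∀ i, 0 < lam i) (hnu : ∀ i, 0 < nu i)
    (A : ℕ → EuclideanSpace ℝ (Fin (n + 1)) ≃ₗ[ℝ] EuclideanSpace ℝ (Fin (n + 1)))
    (hAx : ∀ i, A i x = lam i • x) (hAy : ∀ i, A i y = nu i • y)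
    (q : EuclideanSpace ℝ (Fin (n + 1)))
    (hq : Tendsto (fun i => ‖(A i) p‖⁻¹ • ((A i) p)) atTop (nhds q)) :
    (∃ c d : ℝ, 0 < c ∧ 0 < d ∧ q = ‖c • x + d • y‖⁻¹ • (c • x + d • y)) ↔
      (∃ C : ℝ, 0 < C ∧ ∀ i, C⁻¹ ≤ lam i / nu i ∧ lam i / nu i ≤ C) := by
  obtain ⟨f, g, hfx, hfy, hgx, hgy⟩ := exists_dual_pair hxy
  have hcomb : ∀ s t : ℝ, 0 < s → s • x + t • y ≠ 0 := fun s t hs h =>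
    hs.ne' (LinearIndependent.pair_iff.mp hxy s t h).1
  set u : ℕ → EuclideanSpace ℝ (Fin (n + 1)) := fun i => ‖(A i) p‖⁻¹ • ((A i) p) with hu
  have hAp : ∀ i, ∃ k : ℝ, 0 < k ∧ u i = (k * (a * lam i)) • x + (k * (b * nu i)) • y := by
    intro i
    have hN : 0 < ‖a • x + b • y‖⁻¹ := inv_pos.mpr (norm_pos_iff.mpr (hcomb a b ha))
    have hp0 : p ≠ 0 := by
      rw [hp]
      exact smul_ne_zero hN.ne' (hcomb a b ha)
    have hK : 0 < ‖A i p‖⁻¹ :=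
      inv_pos.mpr (norm_pos_iff.mpr ((A i).map_ne_zero_iff.mpr hp0))
    refine ⟨‖A i p‖⁻¹ * ‖a • x + b • y‖⁻¹, mul_pos hK hN, ?_⟩
    have hApi : A i p = ‖a • x + b • y‖⁻¹ • ((a * lam i) • x + (b * nu i) • y) := by
      conv_lhs => rw [hp]
      simp only [map_smul, map_add, hAx, hAy, smul_smul]
    exact (congrArg (‖A i p‖⁻¹ • ·) hApi).trans (by simp only [smul_add, smul_smul, mul_assoc])
  choose k hk huk using hAp
  have hfu : ∀ i, f (u i) = k i * (a * lam i) := fun i => by simp [huk, hfx, hfy]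
  have hgu : ∀ i, g (u i) = k i * (b * nu i) := fun i => by simp [huk, hgx, hgy]
  have hf : Tendsto (fun i => f (u i)) atTop (nhds (f q)) := (f.continuous.tendsto q).comp hq
  have hg : Tendsto (fun i => g (u i)) atTop (nhds (g q)) := (g.continuous.tendsto q).comp hq
  have hu1 : ∀ i, ‖u i‖ = 1 := fun i => by
    have hui : u i ≠ 0 := by
      rw [huk]
      exact hcomb _ _ (mul_pos (hk i) (mul_pos ha (hlam i)))
    have hApi : A i p ≠ 0 := fun h => hui (by simp [hu, h])
    exact norm_smul_inv_norm (𝕜 := ℝ) hApi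
  constructor
  · rintro ⟨c, d, hc, hd, hqcd⟩
    have hN : 0 < ‖c • x + d • y‖⁻¹ := inv_pos.mpr (norm_pos_iff.mpr (hcomb c d hc))
    have hfq : 0 < f q := by
      have : f q = ‖c • x + d • y‖⁻¹ * c := by
        conv_lhs => rw [hqcd]
        simp [hfx, hfy]
      rw [this]
      positivity
    have hgq : 0 < g q := by
      have : g q = ‖c • x + d • y‖⁻¹ * d := by
        conv_lhs => rw [hqcd]
        simp [hgx, hgy]
      rw [this]
      positivity
    refine exists_two_sided_bound_of_tendsto_pos (fun i => div_pos (hlam i) (hnu i))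
      (L := b / a * (f q / g q)) (by positivity) ?_
    refine ((hf.div hg hgq.ne').const_mul (b / a)).congr fun i => ?_
    have := (hk i).ne'
    have := (hnu i).ne'
    simp only [Pi.div_apply, hfu, hgu]
    field_simp
  · rintro ⟨C, hC, hCr⟩
    have hq1 : ‖q‖ = 1 :=
      tendsto_nhds_unique hq.norm (tendsto_const_nhds.congr fun i => (hu1 i).symm)
    have hqe : q = f q • x + g q • y := by
      refine tendsto_nhds_unique hq (((hf.smul_const x).add (hg.smul_const y)).congr fun i => ?_)
      rw [hfu, hgu]
      exact (huk i).symm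
    have hf0 : 0 ≤ f q := ge_of_tendsto' hf fun i => by
      have := hk i
      have := hlam i
      rw [hfu]
      positivity
    have hg0 : 0 ≤ g q := ge_of_tendsto' hg fun i => by
      have := hk i
      have := hnu i
      rw [hgu]
      positivity
    have hfg : b * f q ≤ C * a * g q :=
      le_of_tendsto_of_tendsto' (hf.const_mul b) (hg.const_mul (C * a)) fun i => by
        have h := (div_le_iff₀ (hnu i)).mp (hCr i).2
        have := mul_le_mul_of_nonneg_left h (mul_pos (mul_pos (hk i) ha) hb).le
        rw [hfu, hgu]
        linarith
    have hgf : a * g q ≤ C * b * f q :=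
      le_of_tendsto_of_tendsto' (hg.const_mul a) (hf.const_mul (C * b)) fun i => by
        have h := (inv_mul_le_iff₀ hC).mp ((le_div_iff₀ (hnu i)).mp (hCr i).1)
        have := mul_le_mul_of_nonneg_left h (mul_pos (mul_pos (hk i) ha) hb).le
        rw [hfu, hgu]
        linarith
    have hq0 : ¬ (f q = 0 ∧ g q = 0) := by
      rintro ⟨h1, h2⟩
      rw [h1, h2] at hqe
      simp [hqe] at hq1
    have hfq : f q ≠ 0 := fun h => hq0 ⟨h, by
      rw [h, mul_zero] at hgf
      exact le_antisymm (nonpos_of_mul_nonpos_right hgf ha) hg0⟩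
    have hgq : g q ≠ 0 := fun h => hq0 ⟨by
      rw [h, mul_zero] at hfg
      exact le_antisymm (nonpos_of_mul_nonpos_right hfg hb) hf0, h⟩
    refine ⟨f q, g q, hf0.lt_of_ne' hfq, hg0.lt_of_ne' hgq, ?_⟩
    rw [← hqe, hq1, inv_one, one_smul]
end

section
/- For a nonempty compact subset B of the unit sphere S² ⊂ ℝ³, let C(B) = {t v : t ∈ [0,1], v ∈ B} be the cone over B with vertex the origin, a nonempty compact subset of the closed unit ball. Let (Bᵢ) be a sequence of nonempty compact subsets of S². Then the sequence of cones (C(Bᵢ)) converges in the Hausdorff metric to some compact set D∞ if and only if (Bᵢ) converges in the Hausdorff metric to some compact set B∞; moreover, in that case D∞ = C(B∞). -/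
open Filter Metric

/-- The cone over `B` with vertex the origin: `{t • v : t ∈ [0,1], v ∈ B}`. -/
def coneSet (B : Set (EuclideanSpace ℝ (Fin 3))) : Set (EuclideanSpace ℝ (Fin 3)) :=
  {x | ∃ t ∈ Set.Icc (0 : ℝ) 1, ∃ v ∈ B, x = t • v}

open TopologicalSpace
open scoped Pointwise

theorem coneSet_nonempty {B : Set (EuclideanSpace ℝ (Fin 3))} (hB : B.Nonempty) :
    (coneSet B).Nonempty :=
  let ⟨v, hv⟩ := hB
  ⟨(1 : ℝ) • v, 1, by simp, v, hv, rfl⟩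

theorem subset_coneSet (B : Set (EuclideanSpace ℝ (Fin 3))) : B ⊆ coneSet B :=
  fun v hv => ⟨1, by simp, v, hv, (one_smul ℝ v).symm⟩

theorem isCompact_coneSet {B : Set (EuclideanSpace ℝ (Fin 3))} (hB : IsCompact B) :
    IsCompact (coneSet B) := by
  have h : coneSet B = Set.Icc (0 : ℝ) 1 • B := by
    ext x
    simp only [coneSet, Set.mem_smul, Set.mem_ofPred_eq, eq_comm]
  rw [h]
  exact isCompact_Icc.smul_set hB

/-- In the Hausdorff distance, a point of a nonempty compact set has a partner in the other set
realizing at most the Hausdorff distance. -/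
theorem IsCompact.exists_dist_le_hausdorffDist {α : Type*} [MetricSpace α] {s t : Set α}
    (hs : IsCompact s) (ht : IsCompact t) (htne : t.Nonempty) {x : α} (hx : x ∈ s) :
    ∃ y ∈ t, dist x y ≤ hausdorffDist s t := by
  obtain ⟨y, hy, hxy⟩ := ht.exists_infDist_eq_dist htne x
  exact ⟨y, hy, hxy ▸ infDist_le_hausdorffDist_of_mem hx
    (hausdorffEDist_ne_top_of_nonempty_of_bounded ⟨x, hx⟩ htne hs.isBounded ht.isBounded)⟩

theorem exists_mem_coneSet_dist_le {A B : Set (EuclideanSpace ℝ (Fin 3))} (hA : IsCompact A)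
    (hB : IsCompact B) (hBne : B.Nonempty) {x : EuclideanSpace ℝ (Fin 3)} (hx : x ∈ coneSet A) :
    ∃ y ∈ coneSet B, dist x y ≤ hausdorffDist A B := by
  obtain ⟨t, ht, v, hv, rfl⟩ := hx
  obtain ⟨w, hw, hvw⟩ := hA.exists_dist_le_hausdorffDist hB hBne hv
  refine ⟨t • w, ⟨t, ht, w, hw, rfl⟩, ?_⟩
  rw [dist_smul₀, Real.norm_of_nonneg ht.1]
  exact (mul_le_of_le_one_left dist_nonneg ht.2).trans hvw

theorem hausdorffDist_coneSet_le {A B : Set (EuclideanSpace ℝ (Fin 3))} (hA : IsCompact A)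
    (hAne : A.Nonempty) (hB : IsCompact B) (hBne : B.Nonempty) :
    hausdorffDist (coneSet A) (coneSet B) ≤ hausdorffDist A B := by
  refine hausdorffDist_le_of_mem_dist hausdorffDist_nonneg
    (fun x hx => exists_mem_coneSet_dist_le hA hB hBne hx) fun x hx => ?_
  rw [hausdorffDist_comm]
  exact exists_mem_coneSet_dist_le hB hA hAne hx

theorem exists_mem_dist_le_two_mul_hausdorffDist_coneSet {A B : Set (EuclideanSpace ℝ (Fin 3))}
    (hA : IsCompact A) (hB : IsCompact B) (hBne : B.Nonempty) (hAs : A ⊆ sphere 0 1)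
    (hBs : B ⊆ sphere 0 1) {x : EuclideanSpace ℝ (Fin 3)} (hx : x ∈ A) :
    ∃ y ∈ B, dist x y ≤ 2 * hausdorffDist (coneSet A) (coneSet B) := by
  obtain ⟨_, ⟨t, ht, v, hv, rfl⟩, h⟩ := (isCompact_coneSet hA).exists_dist_le_hausdorffDist
    (isCompact_coneSet hB) (coneSet_nonempty hBne) (subset_coneSet A hx)
  have hx1 : ‖x‖ = 1 := mem_sphere_zero_iff_norm.1 (hAs hx)
  have hv1 : ‖v‖ = 1 := mem_sphere_zero_iff_norm.1 (hBs hv)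
  refine ⟨v, hv, ?_⟩
  have h1 : dist (t • v) v = 1 - t := by
    have : t • v - v = (t - 1) • v := by module
    rw [dist_eq_norm, this, norm_smul, hv1, mul_one, Real.norm_of_nonpos (by linarith [ht.2])]
    ring
  have h2 : 1 - t ≤ dist x (t • v) := by
    have := norm_sub_norm_le x (t • v)
    rwa [norm_smul, hx1, hv1, mul_one, Real.norm_of_nonneg ht.1, ← dist_eq_norm] at this
  linarith [dist_triangle x (t • v) v]

/-- For subsets of the unit sphere, passing to cones shrinks the Hausdorff distance by at most a
factor of two. -/
theorem hausdorffDist_le_two_mul_hausdorffDist_coneSet {A B : Set (EuclideanSpace ℝ (Fin 3))}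
    (hA : IsCompact A) (hAne : A.Nonempty) (hB : IsCompact B) (hBne : B.Nonempty)
    (hAs : A ⊆ sphere 0 1) (hBs : B ⊆ sphere 0 1) :
    hausdorffDist A B ≤ 2 * hausdorffDist (coneSet A) (coneSet B) := by
  refine hausdorffDist_le_of_mem_dist (mul_nonneg zero_le_two hausdorffDist_nonneg)
    (fun x hx => exists_mem_dist_le_two_mul_hausdorffDist_coneSet hA hB hBne hAs hBs hx)
    fun x hx => ?_
  rw [hausdorffDist_comm]
  exact exists_mem_dist_le_two_mul_hausdorffDist_coneSet hB hA hAne hBs hAs hx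

/-- The cone over a nonempty compact set, as a nonempty compact set. -/
def nonemptyCompactsCone (K : NonemptyCompacts (EuclideanSpace ℝ (Fin 3))) :
    NonemptyCompacts (EuclideanSpace ℝ (Fin 3)) :=
  ⟨⟨coneSet K, isCompact_coneSet K.isCompact⟩, coneSet_nonempty K.nonempty⟩

theorem lipschitzWith_nonemptyCompactsCone : LipschitzWith 1 nonemptyCompactsCone :=
  LipschitzWith.of_dist_le_mul fun K L => by
    rw [NNReal.coe_one, one_mul]
    exact hausdorffDist_coneSet_le K.isCompact K.nonempty L.isCompact L.nonempty

theorem cauchySeq_of_cauchySeq_nonemptyCompactsCone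
    {K : ℕ → NonemptyCompacts (EuclideanSpace ℝ (Fin 3))}
    (hK : ∀ i, (K i : Set (EuclideanSpace ℝ (Fin 3))) ⊆ sphere 0 1)
    (h : CauchySeq fun i => nonemptyCompactsCone (K i)) : CauchySeq K := by
  rw [Metric.cauchySeq_iff] at h ⊢
  intro ε hε
  obtain ⟨N, hN⟩ := h (ε / 2) (half_pos hε)
  refine ⟨N, fun m hm n hn => ?_⟩
  have h1 : dist (K m) (K n) ≤
      2 * dist (nonemptyCompactsCone (K m)) (nonemptyCompactsCone (K n)) :=
    hausdorffDist_le_two_mul_hausdorffDist_coneSet (K m).isCompact (K m).nonempty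
      (K n).isCompact (K n).nonempty (hK m) (hK n)
  linarith [hN m hm n hn]

/-- Lemma B.1 (lem:conelim), Euclidean-ball model: for nonempty compact subsets `Bᵢ` of the
unit sphere `S²`, the cones `C(Bᵢ)` converge in the Hausdorff metric to a compact set if and
only if the `Bᵢ` converge in the Hausdorff metric to a compact set; moreover in that case the
limit of the cones is the cone over the limit. -/
theorem stmt4 (B : ℕ → Set (EuclideanSpace ℝ (Fin 3)))
    (hBsub : ∀ i, B i ⊆ Metric.sphere (0 : EuclideanSpace ℝ (Fin 3)) 1)
    (hBne : ∀ i, (B i).Nonempty) (hBc : ∀ i, IsCompact (B i)) :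
    ((∃ D : Set (EuclideanSpace ℝ (Fin 3)), D.Nonempty ∧ IsCompact D ∧
        Tendsto (fun i => hausdorffDist (coneSet (B i)) D) atTop (nhds 0)) ↔
      (∃ Binf : Set (EuclideanSpace ℝ (Fin 3)), Binf.Nonempty ∧ IsCompact Binf ∧
        Tendsto (fun i => hausdorffDist (B i) Binf) atTop (nhds 0))) ∧
    (∀ D Binf : Set (EuclideanSpace ℝ (Fin 3)), D.Nonempty → IsCompact D →
      Binf.Nonempty → IsCompact Binf →
      Tendsto (fun i => hausdorffDist (coneSet (B i)) D) atTop (nhds 0) →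
      Tendsto (fun i => hausdorffDist (B i) Binf) atTop (nhds 0) →
      D = coneSet Binf) := by
  let K : ℕ → NonemptyCompacts (EuclideanSpace ℝ (Fin 3)) := fun i => ⟨⟨B i, hBc i⟩, hBne i⟩
  have cone_tendsto {L : NonemptyCompacts (EuclideanSpace ℝ (Fin 3))}
      (hL : Tendsto K atTop (nhds L)) :
      Tendsto (fun i => nonemptyCompactsCone (K i)) atTop (nhds (nonemptyCompactsCone L)) :=
    (lipschitzWith_nonemptyCompactsCone.continuous.tendsto L).comp hL
  refine ⟨⟨?_, ?_⟩, ?_⟩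
  · rintro ⟨D, hDne, hDc, hD⟩
    have hD' : Tendsto (fun i => nonemptyCompactsCone (K i)) atTop (nhds ⟨⟨D, hDc⟩, hDne⟩) :=
      tendsto_iff_dist_tendsto_zero.2 hD
    obtain ⟨L, hL⟩ := cauchySeq_tendsto_of_complete
      (cauchySeq_of_cauchySeq_nonemptyCompactsCone hBsub hD'.cauchySeq)
    exact ⟨L, L.nonempty, L.isCompact, tendsto_iff_dist_tendsto_zero.1 hL⟩
  · rintro ⟨L, hLne, hLc, hL⟩
    have hL' : Tendsto K atTop (nhds ⟨⟨L, hLc⟩, hLne⟩) := tendsto_iff_dist_tendsto_zero.2 hL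
    exact ⟨coneSet L, coneSet_nonempty hLne, isCompact_coneSet hLc,
      tendsto_iff_dist_tendsto_zero.1 (cone_tendsto hL')⟩
  · intro D L hDne hDc hLne hLc hD hL
    have hD' : Tendsto (fun i => nonemptyCompactsCone (K i)) atTop (nhds ⟨⟨D, hDc⟩, hDne⟩) :=
      tendsto_iff_dist_tendsto_zero.2 hD
    have hL' : Tendsto K atTop (nhds ⟨⟨L, hLc⟩, hLne⟩) := tendsto_iff_dist_tendsto_zero.2 hL
    exact congrArg SetLike.coe (tendsto_nhds_unique hD' (cone_tendsto hL'))
end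

section
/- Fix a real number λ > 1 and let g : ℝ² → ℝ² be the linear map g(x, y) = (λ x, λ⁻¹ y). Let Q = {(x, y) ∈ ℝ² : x ≥ 0, y ≥ 0} ∖ {(0,0)}, which is invariant under g and g⁻¹. Then: (a) for every continuous path α : [0,1] → Q with α(0) on the positive y-axis (first coordinate 0) and α(1) on the positive x-axis (second coordinate 0), and every integer n, the image of α meets the image of gⁿ ∘ α; (b) consequently, the action of ℤ on Q given by n • q = gⁿ(q) is not properly discontinuous; indeed the compact segment K = {(t, 1−t) : t ∈ [0,1]} ⊆ Q satisfies gⁿ(K) ∩ K ≠ ∅ for every n ∈ ℤ. -/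
/-- A continuous logarithm of a path in a rotated slit plane varies like the principal one. -/
theorem sub_eq_log_sub_log_of_exp_eq {q M : ℝ → ℂ} (hq : Continuous q) (hM : Continuous M)
    (hexp : ∀ t, Complex.exp (M t) = q t) (c : ℂ) (hc : ∀ t, c * q t ∈ Complex.slitPlane)
    (a b : ℝ) : M b - M a = Complex.log (c * q b) - Complex.log (c * q a) := by
  have hcont : Continuous fun t => M t - Complex.log (c * q t) :=
    hM.sub ((continuous_const.mul hq).clog hc)
  have hval : ∀ t, Complex.exp (M t - Complex.log (c * q t)) = c⁻¹ := by
    intro t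
    have h0 := Complex.slitPlane_ne_zero (hc t)
    have hc0 := left_ne_zero_of_mul h0
    have hq0 := right_ne_zero_of_mul h0
    rw [Complex.exp_sub, hexp, Complex.exp_log h0]
    field_simp
  have key := Complex.isCoveringMap_exp.const_of_comp hcont
    (fun s t => Subtype.ext ((hval s).trans (hval t).symm)) b a
  linear_combination key

/-- A nowhere vanishing continuous map to `ℂ` from the plane has a continuous logarithm. -/
theorem exists_continuous_exp_eq {F : ℝ × ℝ → ℂ} (hF : Continuous F) (h0 : ∀ p, F p ≠ 0) :
    ∃ L : ℝ × ℝ → ℂ, Continuous L ∧ ∀ p, Complex.exp (L p) = F p := by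
  obtain ⟨L, ⟨-, hL⟩, -⟩ := Complex.isCoveringMapOn_exp.existsUnique_continuousMap_lifts
    ⟨F, hF⟩ (a₀ := 0) (Complex.exp_log (h0 0)) h0
  exact ⟨L, L.continuous, fun p => congrFun hL p⟩

/-- A path in the closed quadrant minus the origin joining the two boundary rays meets its image
under `(x, y) ↦ (m x, m⁻¹ y)`: otherwise the difference of the two paths would have a continuous
logarithm on the parameter plane, but it winds once around the triangle `0 ≤ t ≤ s ≤ 1`. -/
theorem exists_hyperbolic_apply_eq {m : ℝ} (hm : 1 < m) {x y : ℝ → ℝ} (hx : Continuous x)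
    (hy : Continuous y) (hx0 : ∀ t, 0 ≤ x t) (hy0 : ∀ t, 0 ≤ y t)
    (hxy : ∀ t, x t ≠ 0 ∨ y t ≠ 0) (h0 : x 0 = 0) (h1 : y 1 = 0) :
    ∃ s t, m * x t = x s ∧ m⁻¹ * y t = y s := by
  by_contra! hne
  have hm0 : 0 < m := by linarith
  have hmi : m⁻¹ < 1 := inv_lt_one_of_one_lt₀ hm
  have hmi0 : 0 < m⁻¹ := inv_pos.2 hm0
  set F : ℝ × ℝ → ℂ := fun p => ⟨x p.1 - m * x p.2, y p.1 - m⁻¹ * y p.2⟩ with hFdef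
  have hF : Continuous F := by
    have : F = fun p => ((x p.1 - m * x p.2 : ℝ) : ℂ) + ((y p.1 - m⁻¹ * y p.2 : ℝ) : ℂ) *
        Complex.I := by
      funext p
      exact Complex.mk_eq_add_mul_I _ _
    rw [this]
    fun_prop
  have hF0 : ∀ p, F p ≠ 0 := by
    intro p hp
    have hre := congrArg Complex.re hp
    have him := congrArg Complex.im hp
    simp only [hFdef, Complex.zero_re, Complex.zero_im] at hre him
    exact hne p.1 p.2 (by linarith) (by linarith)
  obtain ⟨L, hL, hexp⟩ := exists_continuous_exp_eq hF hF0
  have hya : 0 < y 0 := lt_of_le_of_ne (hy0 0) (by simpa [h0, eq_comm] using hxy 0)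
  have hxb : 0 < x 1 := lt_of_le_of_ne (hx0 1) (by simpa [h1, eq_comm] using hxy 1)
  have bottom := sub_eq_log_sub_log_of_exp_eq (q := fun s => F (s, 0)) (M := fun s => L (s, 0))
    (by fun_prop) (by fun_prop) (fun s => hexp _) 1 (by
      intro s
      have h := hF0 (s, 0)
      rw [Complex.mem_slitPlane_iff]
      simp only [hFdef, ne_eq, Complex.ext_iff, Complex.zero_re, Complex.zero_im, h0, mul_zero,
        sub_zero, one_mul, not_and] at h ⊢
      rcases (hx0 s).eq_or_lt with h' | h'
      · exact Or.inr (h h'.symm)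
      · exact Or.inl h') 0 1
  have right := sub_eq_log_sub_log_of_exp_eq (q := fun t => F (1, t)) (M := fun t => L (1, t))
    (by fun_prop) (by fun_prop) (fun s => hexp _) Complex.I (by
      intro t
      have h := hF0 (1, t)
      rw [Complex.mem_slitPlane_iff]
      simp only [hFdef, ne_eq, Complex.ext_iff, Complex.zero_re, Complex.zero_im, h1, zero_sub,
        Complex.I_mul_re, Complex.I_mul_im, neg_neg, not_and] at h ⊢
      rcases (mul_nonneg hmi0.le (hy0 t)).eq_or_lt with h' | h'
      · exact Or.inr fun h'' => h h'' (by rw [← h', neg_zero])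
      · exact Or.inl h') 0 1
  have diagonal := sub_eq_log_sub_log_of_exp_eq (q := fun t => F (t, t)) (M := fun t => L (t, t))
    (by fun_prop) (by fun_prop) (fun s => hexp _) (-1) (by
      intro t
      rw [Complex.mem_slitPlane_iff]
      simp only [hFdef, neg_one_mul, Complex.neg_re, Complex.neg_im]
      rcases (hx0 t).eq_or_lt with h' | h'
      · have hyt : 0 < y t := lt_of_le_of_ne (hy0 t) (by simpa [← h', eq_comm] using hxy t)
        right
        nlinarith
      · left
        nlinarith) 0 1
  have him := congrArg Complex.im (show Complex.log (1 * F (1, 0)) - Complex.log (1 * F (0, 0)) +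
      (Complex.log (Complex.I * F (1, 1)) - Complex.log (Complex.I * F (1, 0))) =
      Complex.log (-1 * F (1, 1)) - Complex.log (-1 * F (0, 0)) by
    rw [← bottom, ← right, ← diagonal]; ring)
  have arg00 : (F (0, 0)).arg = Real.pi / 2 :=
    Complex.arg_eq_pi_div_two_iff.2 ⟨by simp [hFdef, h0], by simp only [hFdef]; nlinarith⟩
  have argn00 : (-F (0, 0)).arg = -(Real.pi / 2) :=
    Complex.arg_eq_neg_pi_div_two_iff.2
      ⟨by simp [hFdef, h0], by simp only [hFdef, Complex.neg_im]; nlinarith⟩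
  have argI11 : (Complex.I * F (1, 1)).arg = -(Real.pi / 2) :=
    Complex.arg_eq_neg_pi_div_two_iff.2
      ⟨by simp [hFdef, h1], by simp only [hFdef, Complex.I_mul_im]; nlinarith⟩
  have argn11 : (-F (1, 1)).arg = 0 :=
    Complex.arg_eq_zero_iff.2
      ⟨by simp only [hFdef, Complex.neg_re]; nlinarith, by simp [hFdef, h1]⟩
  have arg10 : (F (1, 0)).arg < 0 :=
    Complex.arg_neg_iff.2 (by simp only [hFdef, h1]; nlinarith [mul_pos hmi0 hya])
  have argI10 : 0 ≤ (Complex.I * F (1, 0)).arg :=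
    Complex.arg_nonneg_iff.2 (by simp [hFdef, h0, hxb.le])
  simp only [Complex.add_im, Complex.sub_im, Complex.log_im, one_mul, neg_one_mul, arg00, argn00,
    argI11, argn11] at him
  linarith [Real.pi_pos]


/-- Key step in Proposition C.2 (prop:solv): for `λ > 1` and `g(x,y) = (λx, λ⁻¹y)` acting on
the closed quadrant minus the origin `Q`, (a) any path in `Q` from the positive `y`-axis to
the positive `x`-axis meets all of its iterates under `g`; (b) the ℤ-action `n • q = gⁿ(q)`
is not properly discontinuous: the compact segment `K = {(t, 1−t) : t ∈ [0,1]} ⊆ Q` satisfies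
`gⁿ(K) ∩ K ≠ ∅` for every `n ∈ ℤ`. -/
theorem stmt5 (l : ℝ) (hl : 1 < l)
    (Q : Set (ℝ × ℝ)) (hQ : Q = {p : ℝ × ℝ | 0 ≤ p.1 ∧ 0 ≤ p.2} \ {((0 : ℝ), (0 : ℝ))})
    (g : ℤ → ℝ × ℝ → ℝ × ℝ)
    (hg : ∀ (n : ℤ) (p : ℝ × ℝ), g n p = (l ^ n * p.1, l ^ (-n) * p.2))
    (K : Set (ℝ × ℝ)) (hK : K = {p : ℝ × ℝ | ∃ t ∈ Set.Icc (0 : ℝ) 1, p = (t, 1 - t)}) :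
    (∀ α : ℝ → ℝ × ℝ, ContinuousOn α (Set.Icc 0 1) →
      (∀ t ∈ Set.Icc (0 : ℝ) 1, α t ∈ Q) → (α 0).1 = 0 → (α 1).2 = 0 →
      ∀ n : ℤ, ∃ s ∈ Set.Icc (0 : ℝ) 1, ∃ t ∈ Set.Icc (0 : ℝ) 1, g n (α t) = α s) ∧
    (IsCompact K ∧ K ⊆ Q ∧ ∀ n : ℤ, (g n '' K ∩ K).Nonempty) ∧
    ¬ (∀ K' L : Set (ℝ × ℝ), K' ⊆ Q → L ⊆ Q → IsCompact K' → IsCompact L →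
        {n : ℤ | (g n '' K' ∩ L).Nonempty}.Finite) := by
  have hl0 : 0 < l := by linarith
  have hmemQ : ∀ p : ℝ × ℝ, p ∈ Q ↔ 0 ≤ p.1 ∧ 0 ≤ p.2 ∧ (p.1 ≠ 0 ∨ p.2 ≠ 0) := by
    intro p
    simp only [hQ, Set.mem_sdiff, Set.mem_ofPred_eq, Set.mem_singleton_iff, Prod.ext_iff, and_assoc]
    tauto
  have hginv : ∀ (n : ℤ) (p q : ℝ × ℝ), g n p = q → g (-n) q = p := by
    rintro n p q rfl
    simp only [hg, zpow_neg, inv_inv]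
    ext <;> simp [(zpow_pos hl0 n).ne']
  have hmeet : ∀ α : ℝ → ℝ × ℝ, ContinuousOn α (Set.Icc 0 1) →
      (∀ t ∈ Set.Icc (0 : ℝ) 1, α t ∈ Q) → (α 0).1 = 0 → (α 1).2 = 0 →
      ∀ n : ℤ, ∃ s ∈ Set.Icc (0 : ℝ) 1, ∃ t ∈ Set.Icc (0 : ℝ) 1, g n (α t) = α s := by
    intro α hα hαQ h0 h1
    have hpos : ∀ n : ℤ, 0 < n →
        ∃ s ∈ Set.Icc (0 : ℝ) 1, ∃ t ∈ Set.Icc (0 : ℝ) 1, g n (α t) = α s := by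
      intro n hn
      let c : ℝ → ℝ := fun t => Set.projIcc 0 1 zero_le_one t
      have hcI : ∀ t, c t ∈ Set.Icc (0 : ℝ) 1 := fun t => Subtype.coe_prop _
      have hc : Continuous fun t => α (c t) :=
        hα.comp_continuous (continuous_subtype_val.comp continuous_projIcc) hcI
      have hcQ := fun t => (hmemQ _).1 (hαQ _ (hcI t))
      obtain ⟨s, t, h, h'⟩ := exists_hyperbolic_apply_eq (one_lt_zpow₀ hl hn)
        (x := fun t => (α (c t)).1) (y := fun t => (α (c t)).2) hc.fst hc.snd
        (fun t => (hcQ t).1) (fun t => (hcQ t).2.1) (fun t => (hcQ t).2.2)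
        (by simpa [c] using h0) (by simpa [c] using h1)
      refine ⟨c s, hcI s, c t, hcI t, ?_⟩
      rw [hg, zpow_neg]
      exact Prod.ext h h'
    intro n
    rcases lt_trichotomy n 0 with hn | rfl | hn
    · obtain ⟨s, hs, t, ht, h⟩ := hpos (-n) (by omega)
      exact ⟨t, ht, s, hs, by simpa using hginv _ _ _ h⟩
    · exact ⟨0, by simp, 0, by simp, by simp [hg]⟩
    · exact hpos n hn
  have hKimage : K = (fun t : ℝ => (t, 1 - t)) '' Set.Icc 0 1 := by
    rw [hK]
    ext p
    simp [eq_comm]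
  have hKcompact : IsCompact K := by
    rw [hKimage]
    exact isCompact_Icc.image (by fun_prop)
  have hsegQ : ∀ t ∈ Set.Icc (0 : ℝ) 1, (t, 1 - t) ∈ Q := by
    rintro t ⟨h0, h1⟩
    refine (hmemQ _).2 ⟨h0, sub_nonneg.2 h1, ?_⟩
    by_contra! h
    linarith [h.1, h.2]
  have hKQ : K ⊆ Q := by
    rw [hKimage]
    exact Set.image_subset_iff.2 hsegQ
  have hKmeet : ∀ n : ℤ, (g n '' K ∩ K).Nonempty := by
    intro n
    obtain ⟨s, hs, t, ht, h⟩ :=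
      hmeet (fun t => (t, 1 - t)) (by fun_prop) hsegQ rfl (sub_self 1) n
    rw [hKimage]
    exact ⟨_, ⟨_, ⟨t, ht, rfl⟩, h⟩, s, hs, rfl⟩
  refine ⟨hmeet, ⟨hKcompact, hKQ, hKmeet⟩, fun h => ?_⟩
  refine Set.infinite_univ (α := ℤ) ((h K K hKQ hKQ hKcompact hKcompact).subset ?_)
  exact fun n _ => hKmeet n
end

section
/- Let p : X → Y be a surjective covering map between topological spaces, with X connected and Y compact, and let G be a group acting on X by homeomorphisms such that p(g • x) = p(x) for all g ∈ G and x ∈ X, and such that G acts transitively on each fiber p⁻¹(y) (so X is a regular cover of Y with deck-transformation group G). Let A be a closed subset of X such that for every g ∈ G either g • A = A or (g • A) ∩ A = ∅, and such that the family of sets {g • A : g ∈ G} is locally finite in X. Then p(A) is a compact subset of Y, and the restriction p|A : A → p(A), with the subspace topologies, is a covering map. -/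
open scoped Pointwise

section Translates

variable {X G : Type*} [Group G] [MulAction G X] {A : Set X}

theorem smul_eq_self_of_mem_of_smul_mem (heq : ∀ g : G, g • A = A ∨ (g • A) ∩ A = ∅)
    {g : G} {x : X} (hx : x ∈ A) (hgx : g • x ∈ A) : g • A = A :=
  (heq g).resolve_right <| Set.Nonempty.ne_empty ⟨g • x, Set.smul_mem_smul_set hx, hgx⟩

/-- Any union of members of a locally finite collection of closed translates is closed. -/
theorem isClosed_sUnion_translates [TopologicalSpace X]
    (hcont : ∀ g : G, Continuous fun x : X => g • x) (hA : IsClosed A)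
    (hlf : ∀ x : X, ∃ U ∈ nhds x,
      {B : Set X | (∃ g : G, B = g • A) ∧ (B ∩ U).Nonempty}.Finite)
    {S : Set (Set X)} (hS : ∀ B ∈ S, ∃ g : G, B = g • A) : IsClosed (⋃₀ S) := by
  rw [Set.sUnion_eq_iUnion]
  refine LocallyFinite.isClosed_iUnion (fun x => ?_) fun B => ?_
  · obtain ⟨U, hU, hfin⟩ := hlf x
    exact ⟨U, hU, (hfin.preimage Subtype.val_injective.injOn).subset fun B hB => ⟨hS B B.2, hB⟩⟩
  · obtain ⟨g, hg⟩ := hS B B.2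
    rw [hg, ← Set.preimage_smul_inv]
    exact hA.preimage (hcont g⁻¹)

theorem preimage_image_eq_sUnion_translates {Y : Type*} {p : X → Y}
    (hfib : ∀ (g : G) (x : X), p (g • x) = p x)
    (htrans : ∀ x x' : X, p x = p x' → ∃ g : G, g • x = x') :
    p ⁻¹' (p '' A) = ⋃₀ Set.range fun g : G => g • A := by
  ext x
  constructor
  · rintro ⟨a, ha, hax⟩
    obtain ⟨g, rfl⟩ := htrans a x hax
    exact ⟨g • A, ⟨g, rfl⟩, Set.smul_mem_smul_set ha⟩
  · rintro ⟨_, ⟨g, rfl⟩, a, ha, rfl⟩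
    exact ⟨a, ha, (hfib g a).symm⟩

end Translates

/-- If two elements of a group acting by deck transformations of a connected covering agree at
one point, then they agree everywhere. -/
theorem IsCoveringMap.smul_eq_smul_of_smul_eq {X Y G : Type*} [TopologicalSpace X]
    [TopologicalSpace Y] {p : X → Y} (hp : IsCoveringMap p) [PreconnectedSpace X] [Group G]
    [MulAction G X] (hcont : ∀ g : G, Continuous fun x : X => g • x)
    (hfib : ∀ (g : G) (x : X), p (g • x) = p x) {g h : G} {x : X} (hx : g • x = h • x) (x' : X) :
    g • x' = h • x' :=
  congrFun (hp.eq_of_comp_eq (hcont g) (hcont h) (by ext z; simp [hfib]) x hx) x'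

/-- Around a point of a closed set `A` with locally finite disjoint translates, a covering map is
injective on some open neighborhood that meets the saturation of `A` only in `A`. -/
theorem exists_isOpen_injOn_inter_preimage_image_subset {X Y G : Type*} [TopologicalSpace X]
    [TopologicalSpace Y] {p : X → Y} (hp : IsCoveringMap p) [Group G] [MulAction G X]
    (hcont : ∀ g : G, Continuous fun x : X => g • x)
    (hfib : ∀ (g : G) (x : X), p (g • x) = p x)
    (htrans : ∀ x x' : X, p x = p x' → ∃ g : G, g • x = x')
    {A : Set X} (hA : IsClosed A) (heq : ∀ g : G, g • A = A ∨ (g • A) ∩ A = ∅)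
    (hlf : ∀ x : X, ∃ U ∈ nhds x,
      {B : Set X | (∃ g : G, B = g • A) ∧ (B ∩ U).Nonempty}.Finite)
    {x : X} (hx : x ∈ A) :
    ∃ V : Set X, IsOpen V ∧ x ∈ V ∧ V.InjOn p ∧ V ∩ p ⁻¹' (p '' A) ⊆ A := by
  obtain ⟨φ, hxφ, hφ⟩ := hp.isLocalHomeomorph x
  have hZ : IsClosed (⋃₀ {B : Set X | (∃ g : G, B = g • A) ∧ B ≠ A}) :=
    isClosed_sUnion_translates hcont hA hlf fun B hB => hB.1
  refine ⟨φ.source ∩ (⋃₀ {B : Set X | (∃ g : G, B = g • A) ∧ B ≠ A})ᶜ,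
    φ.open_source.inter hZ.isOpen_compl, ⟨hxφ, ?_⟩, ?_, ?_⟩
  · rintro ⟨_, ⟨⟨g, rfl⟩, hne⟩, hxg⟩
    exact ((heq g).resolve_left hne).le ⟨hxg, hx⟩
  · rw [hφ]
    exact φ.injOn.mono Set.inter_subset_left
  · rintro v ⟨⟨-, hv⟩, hvA⟩
    rw [preimage_image_eq_sUnion_translates hfib htrans] at hvA
    obtain ⟨_, ⟨g, rfl⟩, hvg⟩ := hvA
    by_contra hvA
    exact hv ⟨g • A, ⟨⟨g, rfl⟩, fun h => hvA (h ▸ hvg)⟩, hvg⟩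

/-- The restriction of a regular connected covering to a closed set with locally finite disjoint
translates is a covering of its image. -/
theorem IsCoveringMap.restrict_of_locallyFinite_translates {X Y G : Type*} [TopologicalSpace X]
    [TopologicalSpace Y] {p : X → Y} (hp : IsCoveringMap p) [PreconnectedSpace X] [Group G]
    [MulAction G X] (hcont : ∀ g : G, Continuous fun x : X => g • x)
    (hfib : ∀ (g : G) (x : X), p (g • x) = p x)
    (htrans : ∀ x x' : X, p x = p x' → ∃ g : G, g • x = x')
    {A : Set X} (hA : IsClosed A) (heq : ∀ g : G, g • A = A ∨ (g • A) ∩ A = ∅)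
    (hlf : ∀ x : X, ∃ U ∈ nhds x,
      {B : Set X | (∃ g : G, B = g • A) ∧ (B ∩ U).Nonempty}.Finite) :
    IsCoveringMap (Set.MapsTo.restrict p A (p '' A) (Set.mapsTo_image p A)) := by
  set f := Set.MapsTo.restrict p A (p '' A) (Set.mapsTo_image p A)
  have hfval (a : A) : (f a : Y) = p a := rfl
  have f_cont : Continuous f := hp.continuous.restrict _
  rintro ⟨_, x, hx, rfl⟩
  obtain ⟨V, hV, hxV, inj, hVA⟩ :=
    exists_isOpen_injOn_inter_preimage_image_subset hp hcont hfib htrans hA heq hlf hx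
  let I := {a : A // p x = p a}
  have : DiscreteTopology (p ⁻¹' {p x}) := (hp (p x)).1
  have : DiscreteTopology I :=
    .of_continuous_injective (β := p ⁻¹' {p x}) (f := fun i => ⟨i.1.1, i.2.symm⟩)
      ((continuous_subtype_val.comp continuous_subtype_val).subtype_mk _)
      fun i j hij => Subtype.ext (Subtype.ext (congrArg (fun z : p ⁻¹' {p x} => (z : X)) hij))
  choose γ hγ using fun i : I => htrans x i.1 i.2
  have hγA (i : I) : γ i • A = A :=
    smul_eq_self_of_mem_of_smul_mem heq hx (by rw [hγ]; exact i.1.2)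
  have p_inv (g : G) (z : X) : p (g⁻¹ • z) = p z := hfib _ _
  let S (i : I) : Set A := {a | (γ i)⁻¹ • (a : X) ∈ V}
  let W : Set (p '' A) := Subtype.val ⁻¹' (p '' V)
  have hS (i : I) : IsOpen (S i) := hV.preimage ((hcont _).comp continuous_subtype_val)
  have hW : IsOpen W := (hp.isOpenMap V hV).preimage continuous_subtype_val
  have surj (i : I) : (S i).SurjOn f W := by
    rintro ⟨_, hzA⟩ ⟨v, hv, rfl⟩
    have hgv : γ i • v ∈ A := hγA i ▸ Set.smul_mem_smul_set (hVA ⟨hv, hzA⟩)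
    exact ⟨⟨γ i • v, hgv⟩, by simpa [S] using hv, Subtype.ext (hfib _ _)⟩
  have : Nonempty I := ⟨⟨⟨x, hx⟩, rfl⟩⟩
  have : Nonempty (p '' A → A) := ⟨fun _ => ⟨x, hx⟩⟩
  refine (IsEvenlyCovered.of_trivialization (I := I) (t := hW.trivializationDiscrete S W
    (fun i T hT => ⟨fun h => (h.preimage f_cont).inter (hS i), fun h => ?_⟩)
    (fun i a ha b hb hab => ?_) surj (fun i j hij => ?_) fun a ha => ?_)
    ⟨x, hxV, rfl⟩).to_isEvenlyCovered_preimage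
  · obtain ⟨O, hO, hOT⟩ := isOpen_induced_iff.mp h
    have hTO : T = Subtype.val ⁻¹' (p '' (O ∩ (fun z => (γ i)⁻¹ • z) ⁻¹' V)) := by
      ext z
      constructor
      · intro hz
        obtain ⟨a, ha, rfl⟩ := surj i (hT hz)
        have haO : a ∈ Subtype.val ⁻¹' O := hOT ▸ ⟨hz, ha⟩
        exact ⟨a, ⟨haO, ha⟩, rfl⟩
      · rintro ⟨o, ⟨ho, hoV⟩, hoz⟩
        have hoA : (γ i)⁻¹ • o ∈ A :=
          hVA ⟨hoV, by rw [Set.mem_preimage, p_inv, hoz]; exact z.2⟩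
        have hoA' : o ∈ A := by
          rw [← hγA i]
          exact Set.mem_smul_set_iff_inv_smul_mem.mpr hoA
        have hoT : (⟨o, hoA'⟩ : A) ∈ f ⁻¹' T ∩ S i := hOT ▸ ho
        have hfo : f ⟨o, hoA'⟩ = z := Subtype.ext hoz
        exact hfo ▸ hoT.1
    rw [hTO]
    exact (hp.isOpenMap _ (hO.inter (hV.preimage (hcont _)))).preimage continuous_subtype_val
  · exact Subtype.ext <| MulAction.injective (γ i)⁻¹ <| inj ha hb <| by
      simpa only [p_inv, hfval] using Subtype.ext_iff.mp hab
  · refine Set.disjoint_left.mpr fun a hi hj => hij ?_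
    have hv : (γ i)⁻¹ • (a : X) = (γ j)⁻¹ • (a : X) := inj hi hj (by simp only [p_inv])
    have hag : γ i • (γ i)⁻¹ • (a : X) = γ j • (γ i)⁻¹ • (a : X) := by
      rw [smul_inv_smul, hv, smul_inv_smul]
    have hx' := hp.smul_eq_smul_of_smul_eq hcont hfib hag x
    exact Subtype.ext (Subtype.ext (by rwa [hγ, hγ] at hx'))
  · obtain ⟨v, hv, hva⟩ := ha
    obtain ⟨g, hg⟩ := htrans v a hva
    have hvA : v ∈ A := hVA ⟨hv, a, a.2, hva.symm⟩
    have hgA : g • A = A := smul_eq_self_of_mem_of_smul_mem heq hvA (hg ▸ a.2)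
    let i : I := ⟨⟨g • x, hgA ▸ Set.smul_mem_smul_set hx⟩, (hfib g x).symm⟩
    refine Set.mem_iUnion.mpr ⟨i, ?_⟩
    have hgv : γ i • v = a := (hp.smul_eq_smul_of_smul_eq hcont hfib (hγ i) v).trans hg
    simpa [S, ← hgv] using hv

/-- Proposition 2.10 (prop:lfin), topological core: let `p : X → Y` be a surjective covering
map with `X` connected and `Y` compact, on which a group `G` acts by homeomorphisms over `p`,
transitively on fibers (so `X` is a regular cover with deck group `G`). If `A ⊆ X` is closed,
each translate `g • A` either equals `A` or is disjoint from it, and the collection of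
translates is locally finite, then `p(A)` is compact and `p|A : A → p(A)` is a covering map. -/
theorem stmt7 {X Y : Type*} [TopologicalSpace X] [TopologicalSpace Y]
    (p : X → Y) (hp : IsCoveringMap p) (hsurj : Function.Surjective p)
    [ConnectedSpace X] [CompactSpace Y]
    (G : Type*) [Group G] [MulAction G X]
    (hcont : ∀ g : G, Continuous fun x : X => g • x)
    (hfib : ∀ (g : G) (x : X), p (g • x) = p x)
    (htrans : ∀ x x' : X, p x = p x' → ∃ g : G, g • x = x')
    (A : Set X) (hA : IsClosed A)
    (heq : ∀ g : G, g • A = A ∨ (g • A) ∩ A = ∅)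
    (hlf : ∀ x : X, ∃ U ∈ nhds x,
      {B : Set X | (∃ g : G, B = g • A) ∧ (B ∩ U).Nonempty}.Finite) :
    IsCompact (p '' A) ∧
      IsCoveringMap (Set.MapsTo.restrict p A (p '' A) (Set.mapsTo_image p A)) := by
  refine ⟨IsClosed.isCompact ?_,
    hp.restrict_of_locallyFinite_translates hcont hfib htrans hA heq hlf⟩
  rw [← (hp.isQuotientMap hsurj).isClosed_preimage,
    preimage_image_eq_sUnion_translates hfib htrans]
  refine isClosed_sUnion_translates hcont hA hlf ?_
  rintro _ ⟨g, rfl⟩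
  exact ⟨g, rfl⟩
end

section
/- Let l, m ∈ ℝ and for (a, b) ∈ ℝ² let M(a,b) ∈ GL(3, ℝ) be the matrix with rows (e^a, b·e^a, 0), (0, e^a, 0), (0, 0, e^{la+mb}); then (a,b) ↦ M(a,b) is an injective group homomorphism from (ℝ², +) into GL(3, ℝ). Let Λ ⊆ ℝ² be a lattice (the ℤ-span of an ℝ-basis of ℝ²) and let U ⊆ ℝ³ be the set U = {(x,y,z) : y > 0, z > 0} ∪ {(x,y,z) : x > 0, y = 0, z > 0} ∪ {(x,y,z) : y > 0, z = 0}, which is invariant under every M(a,b). Then the quotient space of U by the action of Λ (acting through (a,b) ↦ M(a,b)) is homeomorphic to T² × [0,1], the product of the 2-torus with a closed interval, if and only if m < 0. -/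
open Real Topology Filter

/-- The action of `(a, b)` on `ℝ³` through the matrix `M(a, b)`. -/
noncomputable def planeAct (l m : ℝ) (q : ℝ × ℝ) (z : Fin 3 → ℝ) : Fin 3 → ℝ :=
  ![exp q.1 * (z 0 + q.2 * z 1), exp q.1 * z 1, exp (l * q.1 + m * q.2) * z 2]

/-- The invariant region `U`. -/
def region : Set (Fin 3 → ℝ) :=
  {z : Fin 3 → ℝ | 0 < z 1 ∧ 0 < z 2} ∪
    {z : Fin 3 → ℝ | 0 < z 0 ∧ z 1 = 0 ∧ 0 < z 2} ∪
    {z : Fin 3 → ℝ | 0 < z 1 ∧ z 2 = 0}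

lemma planeAct_add (l m : ℝ) (q q' : ℝ × ℝ) (z : Fin 3 → ℝ) :
    planeAct l m (q + q') z = planeAct l m q (planeAct l m q' z) := by
  ext i
  fin_cases i
  · simp [planeAct, exp_add]; ring
  · simp [planeAct, exp_add]; ring
  · change exp (l * (q.1 + q'.1) + m * (q.2 + q'.2)) * z 2 =
      exp (l * q.1 + m * q.2) * (exp (l * q'.1 + m * q'.2) * z 2)
    rw [← mul_assoc, ← exp_add]
    ring_nf

lemma planeAct_zero (l m : ℝ) (z : Fin 3 → ℝ) : planeAct l m 0 z = z := by
  ext i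
  fin_cases i <;> simp [planeAct]

lemma planeAct_mem_region (l m : ℝ) (q : ℝ × ℝ) {z : Fin 3 → ℝ} (hz : z ∈ region) :
    planeAct l m q z ∈ region := by
  have h1 := exp_pos q.1
  have h2 := exp_pos (l * q.1 + m * q.2)
  rcases hz with (⟨hy, hz⟩ | ⟨hx, hy, hz⟩) | ⟨hy, hz⟩
  · exact Or.inl (Or.inl ⟨mul_pos h1 hy, mul_pos h2 hz⟩)
  · exact Or.inl (Or.inr ⟨by simpa [planeAct, hy] using mul_pos h1 hx, by simp [planeAct, hy],
      mul_pos h2 hz⟩)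
  · exact Or.inr ⟨mul_pos h1 hy, by simp [planeAct, hz]⟩

lemma region_nonneg {z : Fin 3 → ℝ} (hz : z ∈ region) : 0 ≤ z 1 ∧ 0 ≤ z 2 := by
  rcases hz with (⟨hy, hz⟩ | ⟨hx, hy, hz⟩) | ⟨hy, hz⟩
  · exact ⟨hy.le, hz.le⟩
  · exact ⟨hy.ge, hz.le⟩
  · exact ⟨hy.le, hz.ge⟩

/-- A parametrization of the region by `ℝ² × [0, 1]`, on which the plane acts by translations
of the first factor. -/
noncomputable def param (l k : ℝ) (p : (ℝ × ℝ) × ℝ) : Fin 3 → ℝ :=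
  ![exp p.1.1 * (p.1.2 * min 1 (2 - 2 * p.2) + (1 - min 1 (2 - 2 * p.2))
      + l / k * (min 1 (2 - 2 * p.2) * log (min 1 (2 - 2 * p.2)))),
    exp p.1.1 * min 1 (2 - 2 * p.2),
    exp (l * p.1.1 - k * p.1.2) * min 1 (2 * p.2)]

lemma continuous_param (l k : ℝ) : Continuous (param l k) := by
  have h : Continuous fun p : (ℝ × ℝ) × ℝ =>
      min 1 (2 - 2 * p.2) * log (min 1 (2 - 2 * p.2)) :=
    continuous_mul_log.comp (by fun_prop)
  refine continuous_pi fun i => ?_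
  fin_cases i
  · simp only [param]
    simp only [Fin.zero_eta, Matrix.cons_val_zero]
    fun_prop
  · simp only [param]
    simp only [Fin.mk_one, Matrix.cons_val_one, Matrix.cons_val_zero]
    fun_prop
  · simp only [param]
    simp only [Fin.reduceFinMk, Matrix.cons_val]
    fun_prop

lemma planeAct_param (l k : ℝ) (q : ℝ × ℝ) (p : (ℝ × ℝ) × ℝ) :
    planeAct l (-k) q (param l k p) = param l k (q + p.1, p.2) := by
  ext i
  fin_cases i
  · simp [planeAct, param, exp_add]; ring
  · simp [planeAct, param, exp_add]; ring
  · change exp (l * q.1 + -k * q.2) * (exp (l * p.1.1 - k * p.1.2) * min 1 (2 * p.2)) =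
      exp (l * (q.1 + p.1.1) - k * (q.2 + p.1.2)) * min 1 (2 * p.2)
    rw [← mul_assoc, ← exp_add]
    ring_nf

lemma param_of_le (l k : ℝ) (p : (ℝ × ℝ) × ℝ) (h : p.2 ≤ 1 / 2) :
    param l k p = ![exp p.1.1 * p.1.2, exp p.1.1, exp (l * p.1.1 - k * p.1.2) * (2 * p.2)] := by
  have h1 : min 1 (2 - 2 * p.2) = 1 := min_eq_left (by linarith)
  have h2 : min 1 (2 * p.2) = 2 * p.2 := min_eq_right (by linarith)
  simp [param, h1, h2]

lemma param_of_ge (l k : ℝ) (p : (ℝ × ℝ) × ℝ) (h : 1 / 2 ≤ p.2) :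
    param l k p = ![exp p.1.1 * (p.1.2 * (2 - 2 * p.2) + (1 - (2 - 2 * p.2))
      + l / k * ((2 - 2 * p.2) * log (2 - 2 * p.2))),
      exp p.1.1 * (2 - 2 * p.2), exp (l * p.1.1 - k * p.1.2)] := by
  have h1 : min 1 (2 - 2 * p.2) = 2 - 2 * p.2 := min_eq_right (by linarith)
  have h2 : min 1 (2 * p.2) = 1 := min_eq_left (by linarith)
  simp [param, h1, h2]

lemma param_mem_region (l k : ℝ) (p : (ℝ × ℝ) × ℝ) (h0 : 0 ≤ p.2) (h1 : p.2 ≤ 1) :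
    param l k p ∈ region := by
  rcases le_total p.2 (1 / 2) with h | h
  · rw [param_of_le l k p h]
    rcases h0.eq_or_lt with h0 | h0
    · exact Or.inr ⟨by simp [exp_pos], by simp [← h0]⟩
    · exact Or.inl (Or.inl ⟨by simp [exp_pos], by simp [exp_pos, h0]⟩)
  · rw [param_of_ge l k p h]
    rcases h1.eq_or_lt with h1 | h1
    · exact Or.inl (Or.inr ⟨by simp [h1, exp_pos], by simp [h1], by simp [exp_pos]⟩)
    · exact Or.inl (Or.inl ⟨by simp [exp_pos, h1], by simp [exp_pos]⟩)

/-- Multiplicative form of the invariant `log z - l log y + k x / y`. -/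
noncomputable def expInvariant (l k : ℝ) (z : Fin 3 → ℝ) : ℝ :=
  z 2 * exp (k * (z 0 / z 1) - l * log (z 1))

/-- The invariant `log z - l log y + k x / y` multiplied by `y`. -/
noncomputable def scaledInvariant (l k : ℝ) (z : Fin 3 → ℝ) : ℝ :=
  z 1 * log (z 2) - l * (z 1 * log (z 1)) + k * z 0

/-- An inverse of `param` where `0 < y`. -/
noncomputable def coordLow (l k : ℝ) (z : Fin 3 → ℝ) : (ℝ × ℝ) × ℝ :=
  let T := 1 + log (max 1 (expInvariant l k z)) / k
  ((log (z 1) + log T, z 0 / z 1 - (T - 1) + l / k * log T),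
    (min 1 (expInvariant l k z) + 1 - T⁻¹) / 2)

/-- An inverse of `param` where `0 < z` and the scaled invariant is positive. -/
noncomputable def coordHigh (l k : ℝ) (z : Fin 3 → ℝ) : (ℝ × ℝ) × ℝ :=
  let X := z 1 + scaledInvariant l k z / k
  ((log X, (l * log X - log (z 2)) / k), 1 - z 1 / X / 2)

lemma coordLow_param (l : ℝ) {k : ℝ} (hk : 0 < k) (p : (ℝ × ℝ) × ℝ)
    (h : 0 < param l k p 1) : coordLow l k (param l k p) = p := by
  obtain ⟨⟨A, B⟩, t⟩ := p
  have hA := exp_pos A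
  rcases le_total t (1 / 2) with ht | ht
  · rw [param_of_le l k _ ht] at h ⊢
    have hR : expInvariant l k ![exp A * B, exp A, exp (l * A - k * B) * (2 * t)] = 2 * t := by
      simp only [expInvariant, Matrix.cons_val, Matrix.cons_val_zero, Matrix.cons_val_one, log_exp]
      rw [mul_div_cancel_left₀ _ hA.ne', mul_right_comm, ← exp_add]
      simp
    have h1 : max 1 (2 * t) = 1 := max_eq_left (by linarith)
    have h2 : min 1 (2 * t) = 2 * t := min_eq_right (by linarith)
    simp only [coordLow, hR, h1, h2]
    simp
  · rw [param_of_ge l k _ ht] at h ⊢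
    simp only [Matrix.cons_val_one, Matrix.cons_val_zero] at h
    have he : 0 < 2 - 2 * t := pos_of_mul_pos_right h hA.le
    set e := 2 - 2 * t with he'
    have hquot : exp A * (B * e + (1 - e) + l / k * (e * log e)) / (exp A * e) =
        B + (e⁻¹ - 1) + l / k * log e := by
      field_simp
    have hR : expInvariant l k ![exp A * (B * e + (1 - e) + l / k * (e * log e)), exp A * e,
        exp (l * A - k * B)] = exp (k * (e⁻¹ - 1)) := by
      simp only [expInvariant, Matrix.cons_val, Matrix.cons_val_zero, Matrix.cons_val_one]
      rw [hquot, log_mul hA.ne' he.ne', log_exp, ← exp_add]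
      congr 1
      field_simp
      ring
    have h1e : 1 ≤ e⁻¹ := (one_le_inv₀ he).2 (by linarith)
    have h1 : 1 ≤ exp (k * (e⁻¹ - 1)) := one_le_exp (mul_nonneg hk.le (by linarith))
    have hT : 1 + k * (e⁻¹ - 1) / k = e⁻¹ := by field_simp; ring
    simp only [coordLow, hR, max_eq_right h1, min_eq_left h1, log_exp, hT]
    simp only [Matrix.cons_val_zero, Matrix.cons_val_one, hquot, log_mul hA.ne' he.ne', log_exp,
      log_inv, inv_inv]
    ext
    · simp
    · simp; ring
    · simp [he']; ring

lemma coordHigh_param (l : ℝ) {k : ℝ} (hk : 0 < k) (p : (ℝ × ℝ) × ℝ) (ht0 : 0 ≤ p.2)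
    (ht1 : p.2 ≤ 1) (hS : 0 < scaledInvariant l k (param l k p)) (hz : 0 < param l k p 2) :
    coordHigh l k (param l k p) = p := by
  obtain ⟨⟨A, B⟩, t⟩ := p
  have hA := exp_pos A
  rcases le_total t (1 / 2) with ht | ht
  · exfalso
    rw [param_of_le l k _ ht] at hS hz
    simp only [Matrix.cons_val] at hz
    have hE := exp_pos (l * A - k * B)
    have htt : 0 < 2 * t := pos_of_mul_pos_right hz hE.le
    simp only [scaledInvariant, Matrix.cons_val, Matrix.cons_val_zero, Matrix.cons_val_one,
      log_exp, log_mul hE.ne' htt.ne'] at hS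
    have : 0 < exp A * log (2 * t) := by linarith
    have h2 := log_nonpos htt.le (by linarith)
    nlinarith
  · rw [param_of_ge l k _ ht] at hS hz ⊢
    simp only at ht1
    have he : 0 ≤ 2 - 2 * t := by linarith
    set e := 2 - 2 * t with he'
    have hlog : exp A * e * log (exp A * e) = exp A * (e * A + e * log e) := by
      rcases he.eq_or_lt with h | h
      · simp [← h]
      · rw [log_mul hA.ne' h.ne', log_exp]; ring
    have hX : exp A * e + scaledInvariant l k ![exp A * (B * e + (1 - e) + l / k * (e * log e)),
        exp A * e, exp (l * A - k * B)] / k = exp A := by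
      simp only [scaledInvariant, Matrix.cons_val, Matrix.cons_val_zero, Matrix.cons_val_one,
        log_exp, hlog]
      field_simp
      ring
    simp only [coordHigh, Matrix.cons_val, Matrix.cons_val_zero, Matrix.cons_val_one, hX, log_exp]
    rw [mul_div_cancel_left₀ _ hA.ne']
    ext
    · simp
    · simp [hk.ne']
    · simp [he']; ring

lemma exists_param_eq (l : ℝ) {k : ℝ} (hk : 0 < k) {z : Fin 3 → ℝ} (hz : z ∈ region) :
    ∃ p : (ℝ × ℝ) × ℝ, 0 ≤ p.2 ∧ p.2 ≤ 1 ∧ param l k p = z := by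
  obtain ⟨hy0, hz0⟩ := region_nonneg hz
  by_cases hV : 0 < z 2 ∧ 0 < scaledInvariant l k z
  · obtain ⟨hz2, hS⟩ := hV
    set X := z 1 + scaledInvariant l k z / k with hX
    have hyX : z 1 < X := by have := div_pos hS hk; linarith
    have hX0 : 0 < X := by linarith
    refine ⟨((log X, (l * log X - log (z 2)) / k), 1 - z 1 / X / 2), ?_, ?_, ?_⟩
    · have : z 1 / X ≤ 1 := (div_le_one hX0).2 hyX.le
      simp only; linarith
    · have : 0 ≤ z 1 / X := by positivity
      simp only; linarith
    · rw [param_of_ge]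
      swap
      · have : z 1 / X ≤ 1 := (div_le_one hX0).2 hyX.le
        simp only; linarith
      have he : 2 - 2 * (1 - z 1 / X / 2) = z 1 / X := by ring
      have hlog : z 1 * log (z 1 / X) = z 1 * log (z 1) - z 1 * log X := by
        rcases hy0.eq_or_lt with h | h
        · simp [← h]
        · rw [log_div h.ne' hX0.ne']; ring
      ext i
      fin_cases i
      · simp only [he, exp_log hX0]
        simp only [Fin.zero_eta, Matrix.cons_val_zero]
        have : X * ((l * log X - log (z 2)) / k * (z 1 / X) + (1 - z 1 / X) +
            l / k * (z 1 / X * log (z 1 / X))) =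
            (l * log X - log (z 2)) / k * z 1 + (X - z 1) + l / k * (z 1 * log (z 1 / X)) := by
          field_simp
        rw [this, hlog, hX, add_sub_cancel_left]
        simp only [scaledInvariant]
        field_simp
        ring
      · simp only [he, exp_log hX0]
        simp only [Fin.mk_one, Matrix.cons_val_one, Matrix.cons_val_zero]
        field_simp
      · simp [mul_div_cancel₀ _ hk.ne', exp_log hz2]
  · have hy : 0 < z 1 := by
      rcases hz with (⟨hy, hz⟩ | ⟨hx, hy, hz⟩) | ⟨hy, hz⟩
      · exact hy
      · exact absurd ⟨hz, by simpa [scaledInvariant, hy] using mul_pos hk hx⟩ hV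
      · exact hy
    have hR0 : 0 ≤ expInvariant l k z := mul_nonneg hz0 (exp_pos _).le
    have hR1 : expInvariant l k z ≤ 1 := by
      rcases hz0.eq_or_lt with h | h
      · simp [expInvariant, ← h]
      · have hS : scaledInvariant l k z ≤ 0 := not_lt.1 fun h' => hV ⟨h, h'⟩
        have : scaledInvariant l k z =
            z 1 * (log (z 2) + (k * (z 0 / z 1) - l * log (z 1))) := by
          simp only [scaledInvariant]; field_simp; ring
        rw [this] at hS
        rw [expInvariant]
        nth_rw 1 [← exp_log h]
        rw [← exp_add]
        exact exp_le_one_iff.2 (nonpos_of_mul_nonpos_right hS hy)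
    refine ⟨((log (z 1), z 0 / z 1), expInvariant l k z / 2), by simp only; linarith,
      by simp only; linarith, ?_⟩
    rw [param_of_le _ _ _ (by simp only; linarith)]
    ext i
    fin_cases i
    · simp [exp_log hy, mul_div_cancel₀ _ hy.ne']
    · simp [exp_log hy]
    · simp only [Fin.reduceFinMk, Matrix.cons_val, expInvariant]
      rw [mul_div_cancel₀ _ two_ne_zero, mul_left_comm, ← exp_add]
      simp

lemma continuousAt_coordLow (l : ℝ) {k : ℝ} (hk : 0 < k) {z : Fin 3 → ℝ} (hz : 0 < z 1) :
    ContinuousAt (coordLow l k) z := by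
  have hR : ContinuousAt (expInvariant l k) z := by
    have h0 : ContinuousAt (fun z : Fin 3 → ℝ => z 0) z := (continuous_apply 0).continuousAt
    have h1 : ContinuousAt (fun z : Fin 3 → ℝ => z 1) z := (continuous_apply 1).continuousAt
    have h2 : ContinuousAt (fun z : Fin 3 → ℝ => z 2) z := (continuous_apply 2).continuousAt
    exact h2.mul (((continuousAt_const.mul (h0.div h1 hz.ne')).sub
      (continuousAt_const.mul (h1.log hz.ne'))).rexp)
  have hm : max 1 (expInvariant l k z) ≠ 0 := (lt_max_of_lt_left one_pos).ne'
  have hT0 : 1 + log (max 1 (expInvariant l k z)) / k ≠ 0 :=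
    (add_pos_of_pos_of_nonneg one_pos
      (div_nonneg (log_nonneg (le_max_left _ _)) hk.le)).ne'
  have hT : ContinuousAt (fun z => 1 + log (max 1 (expInvariant l k z)) / k) z := by
    have : ContinuousAt (fun z => max 1 (expInvariant l k z)) z := by fun_prop
    exact continuousAt_const.add ((this.log hm).div_const k)
  have hlT := hT.log hT0
  have hiT := hT.inv₀ hT0
  have hmin : ContinuousAt (fun z => min 1 (expInvariant l k z)) z := by fun_prop
  unfold coordLow
  refine ContinuousAt.prodMk (ContinuousAt.prodMk ?_ ?_) ?_
  · have : ContinuousAt (fun z : Fin 3 → ℝ => log (z 1)) z :=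
      (continuous_apply 1).continuousAt.log hz.ne'
    exact this.add hlT
  · have : ContinuousAt (fun z : Fin 3 → ℝ => z 0 / z 1) z :=
      (continuous_apply 0).continuousAt.div (continuous_apply 1).continuousAt hz.ne'
    exact (this.sub (hT.sub continuousAt_const)).add (continuousAt_const.mul hlT)
  · exact ((hmin.add continuousAt_const).sub hiT).div_const 2

lemma continuousAt_scaledInvariant (l k : ℝ) {z : Fin 3 → ℝ} (hz : 0 < z 2) :
    ContinuousAt (scaledInvariant l k) z := by
  have h : Continuous fun z : Fin 3 → ℝ => z 1 * log (z 1) :=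
    continuous_mul_log.comp (continuous_apply 1)
  have h1 : ContinuousAt (fun z : Fin 3 → ℝ => z 1) z := (continuous_apply 1).continuousAt
  have h2 : ContinuousAt (fun z : Fin 3 → ℝ => log (z 2)) z :=
    (continuous_apply 2).continuousAt.log hz.ne'
  have h0 : ContinuousAt (fun z : Fin 3 → ℝ => z 0) z := (continuous_apply 0).continuousAt
  exact ((h1.mul h2).sub (h.continuousAt.const_mul l)).add (h0.const_mul k)

lemma continuousAt_coordHigh (l : ℝ) {k : ℝ} (hk : 0 < k) {z : Fin 3 → ℝ} (hy : 0 ≤ z 1)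
    (hz : 0 < z 2) (hS : 0 < scaledInvariant l k z) :
    ContinuousAt (coordHigh l k) z := by
  have hX0 : z 1 + scaledInvariant l k z / k ≠ 0 := by positivity
  have hX : ContinuousAt (fun z => z 1 + scaledInvariant l k z / k) z :=
    (continuous_apply 1).continuousAt.add
      ((continuousAt_scaledInvariant l k hz).div_const k)
  have hlX := hX.log hX0
  unfold coordHigh
  refine ContinuousAt.prodMk (ContinuousAt.prodMk hlX ?_) ?_
  · have : ContinuousAt (fun z : Fin 3 → ℝ => log (z 2)) z :=
      (continuous_apply 2).continuousAt.log hz.ne'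
    exact ((continuousAt_const.mul hlX).sub this).div_const k
  · exact continuousAt_const.sub
      (((continuous_apply 1).continuousAt.div hX hX0).div_const 2)

lemma scaledInvariant_pos_or_pos (l : ℝ) {k : ℝ} (hk : 0 < k) {z : Fin 3 → ℝ}
    (hz : z ∈ region) : 0 < z 1 ∨ (0 < z 2 ∧ 0 < scaledInvariant l k z) := by
  rcases hz with (⟨hy, hz⟩ | ⟨hx, hy, hz⟩) | ⟨hy, hz⟩
  · exact Or.inl hy
  · exact Or.inr ⟨hz, by simpa [scaledInvariant, hy] using mul_pos hk hx⟩
  · exact Or.inl hy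

/-- The parametrization as a bijection onto the region. -/
noncomputable def regionEquiv (l : ℝ) {k : ℝ} (hk : 0 < k) :
    (ℝ × ℝ) × unitInterval ≃ region :=
  Equiv.ofBijective
    (fun p => ⟨param l k (p.1, p.2), param_mem_region l k _ p.2.2.1 p.2.2.2⟩) <| by
    constructor
    · intro p p' h
      have h' : param l k (p.1, p.2) = param l k (p'.1, p'.2) := congrArg Subtype.val h
      have key : ((p.1, (p.2 : ℝ)) : (ℝ × ℝ) × ℝ) = (p'.1, (p'.2 : ℝ)) := by
        rcases scaledInvariant_pos_or_pos l hk
          (param_mem_region l k (p.1, p.2) p.2.2.1 p.2.2.2) with h1 | ⟨h1, h2⟩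
        · rw [← coordLow_param l hk _ h1, h', coordLow_param l hk _ (h' ▸ h1)]
        · rw [← coordHigh_param l hk _ p.2.2.1 p.2.2.2 h2 h1, h',
            coordHigh_param l hk _ p'.2.2.1 p'.2.2.2 (h' ▸ h2) (h' ▸ h1)]
      exact Prod.ext (Prod.ext_iff.1 key).1 (Subtype.ext (Prod.ext_iff.1 key).2)
    · rintro ⟨z, hz⟩
      obtain ⟨p, h0, h1, hp⟩ := exists_param_eq l hk hz
      exact ⟨(p.1, ⟨p.2, h0, h1⟩), Subtype.ext hp⟩

lemma regionEquiv_coe (l : ℝ) {k : ℝ} (hk : 0 < k) (p : (ℝ × ℝ) × unitInterval) :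
    (regionEquiv l hk p : Fin 3 → ℝ) = param l k (p.1, p.2) := rfl

lemma continuous_regionEquiv_symm (l : ℝ) {k : ℝ} (hk : 0 < k) :
    Continuous (regionEquiv l hk).symm := by
  have key : Continuous fun u : region =>
      ((((regionEquiv l hk).symm u).1, (((regionEquiv l hk).symm u).2 : ℝ)) : (ℝ × ℝ) × ℝ) := by
    refine continuous_iff_continuousAt.2 fun u => ?_
    have hval : ∀ u : region, param l k (((regionEquiv l hk).symm u).1,
        (((regionEquiv l hk).symm u).2 : ℝ)) = u := fun u => by
      rw [← regionEquiv_coe l hk, Equiv.apply_symm_apply]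
    rcases scaledInvariant_pos_or_pos l hk u.2 with h1 | ⟨h1, h2⟩
    · refine ((continuousAt_coordLow l hk h1).comp continuousAt_subtype_val).congr ?_
      have hy : ContinuousAt (fun u : region => (u : Fin 3 → ℝ) 1) u :=
        ((continuous_apply 1).comp continuous_subtype_val).continuousAt
      filter_upwards [hy.eventually (lt_mem_nhds h1)] with u' hu'
      have := coordLow_param l hk _ ((hval u').symm ▸ hu')
      rw [hval] at this
      exact this
    · refine ((continuousAt_coordHigh l hk (region_nonneg u.2).1 h1 h2).comp
        continuousAt_subtype_val).congr ?_
      have hz : ContinuousAt (fun u : region => (u : Fin 3 → ℝ) 2) u :=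
        ((continuous_apply 2).comp continuous_subtype_val).continuousAt
      have hS : ContinuousAt (fun u : region => scaledInvariant l k u) u :=
        (continuousAt_scaledInvariant l k h1).comp continuousAt_subtype_val
      filter_upwards [hz.eventually (lt_mem_nhds h1), hS.eventually (lt_mem_nhds h2)]
        with u' hu1 hu2
      have := coordHigh_param l hk _ ((regionEquiv l hk).symm u').2.2.1
        ((regionEquiv l hk).symm u').2.2.2 ((hval u').symm ▸ hu2) ((hval u').symm ▸ hu1)
      rw [hval] at this
      exact this
  exact key.fst.prodMk (continuous_induced_rng.2 key.snd)

/-- The region is homeomorphic to `ℝ² × [0, 1]`. -/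
noncomputable def regionHomeomorph (l : ℝ) {k : ℝ} (hk : 0 < k) :
    (ℝ × ℝ) × unitInterval ≃ₜ region where
  toEquiv := regionEquiv l hk
  continuous_toFun := Continuous.subtype_mk ((continuous_param l k).comp (by fun_prop)) _
  continuous_invFun := continuous_regionEquiv_symm l hk

lemma planeAct_regionHomeomorph (l : ℝ) {k : ℝ} (hk : 0 < k) (q : ℝ × ℝ)
    (p : (ℝ × ℝ) × unitInterval) :
    planeAct l (-k) q (regionHomeomorph l hk p) = regionHomeomorph l hk (q + p.1, p.2) :=
  planeAct_param l k q (p.1, p.2)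

/-- The lattice spanned by `v` and `w`. -/
def latticeSpan (v w : ℝ × ℝ) : Set (ℝ × ℝ) := {q : ℝ × ℝ | ∃ i j : ℤ, q = i • v + j • w}

/-- Two points of the region are related if a lattice element maps one to the other. -/
def orbitRel (l m : ℝ) (v w : ℝ × ℝ) (z z' : region) : Prop :=
  ∃ q ∈ latticeSpan v w, planeAct l m q z = z'

lemma equivalence_orbitRel (l m : ℝ) (v w : ℝ × ℝ) : Equivalence (orbitRel l m v w) where
  refl z := ⟨0, ⟨0, 0, by simp⟩, planeAct_zero l m z⟩
  symm := by
    rintro z z' ⟨q, ⟨i, j, rfl⟩, hq⟩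
    refine ⟨-(i • v + j • w), ⟨-i, -j, by module⟩, ?_⟩
    rw [← hq, ← planeAct_add, neg_add_cancel, planeAct_zero]
  trans := by
    rintro z z' z'' ⟨q, ⟨i, j, rfl⟩, hq⟩ ⟨q', ⟨i', j', rfl⟩, hq'⟩
    refine ⟨(i' • v + j' • w) + (i • v + j • w), ⟨i' + i, j' + j, by module⟩, ?_⟩
    rw [planeAct_add, hq, hq']

lemma det_ne_zero_of_linearIndependent {v w : ℝ × ℝ} (h : LinearIndependent ℝ ![v, w]) :
    v.1 * w.2 - v.2 * w.1 ≠ 0 := by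
  intro hD
  rw [LinearIndependent.pair_iff] at h
  obtain ⟨h1, h2⟩ := h w.2 (-v.2) (by ext <;> simp <;> linarith)
  obtain ⟨h3, h4⟩ := h w.1 (-v.1) (by ext <;> simp <;> linarith)
  exact one_ne_zero (h 1 0 (by ext <;> simp <;> linarith)).1

/-- Coordinates in the plane with respect to the basis `v, w`. -/
noncomputable def basisCoord (v w : ℝ × ℝ) (hD : v.1 * w.2 - v.2 * w.1 ≠ 0) :
    ℝ × ℝ ≃ₜ ℝ × ℝ where
  toFun q := ((q.1 * w.2 - q.2 * w.1) / (v.1 * w.2 - v.2 * w.1),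
    (v.1 * q.2 - v.2 * q.1) / (v.1 * w.2 - v.2 * w.1))
  invFun c := c.1 • v + c.2 • w
  left_inv q := by
    ext
    · refine Eq.trans ?_ (mul_div_cancel_right₀ q.1 hD)
      simp only [Prod.fst_add, Prod.smul_fst, smul_eq_mul]
      ring
    · refine Eq.trans ?_ (mul_div_cancel_right₀ q.2 hD)
      simp only [Prod.snd_add, Prod.smul_snd, smul_eq_mul]
      ring
  right_inv c := by
    ext
    · refine Eq.trans ?_ (mul_div_cancel_right₀ c.1 hD)
      simp only [Prod.fst_add, Prod.snd_add, Prod.smul_fst, Prod.smul_snd, smul_eq_mul]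
      ring
    · refine Eq.trans ?_ (mul_div_cancel_right₀ c.2 hD)
      simp only [Prod.fst_add, Prod.snd_add, Prod.smul_fst, Prod.smul_snd, smul_eq_mul]
      ring
  continuous_toFun := by fun_prop
  continuous_invFun := by fun_prop

lemma basisCoord_sub (v w : ℝ × ℝ) (hD : v.1 * w.2 - v.2 * w.1 ≠ 0) (q q' : ℝ × ℝ) :
    basisCoord v w hD (q - q') = basisCoord v w hD q - basisCoord v w hD q' := by
  ext
  · simp [basisCoord]; ring
  · simp [basisCoord]; ring

lemma basisCoord_zsmul_add (v w : ℝ × ℝ) (hD : v.1 * w.2 - v.2 * w.1 ≠ 0) (i j : ℤ) :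
    basisCoord v w hD (i • v + j • w) = ((i : ℝ), (j : ℝ)) := by
  rw [← Int.cast_smul_eq_zsmul ℝ i v, ← Int.cast_smul_eq_zsmul ℝ j w]
  exact (basisCoord v w hD).apply_symm_apply ((i : ℝ), (j : ℝ))

lemma mem_latticeSpan_iff (v w : ℝ × ℝ) (hD : v.1 * w.2 - v.2 * w.1 ≠ 0) (q : ℝ × ℝ) :
    q ∈ latticeSpan v w ↔
      ∃ i j : ℤ, basisCoord v w hD q = ((i : ℝ), (j : ℝ)) := by
  refine exists_congr fun i => exists_congr fun j => ?_
  rw [← basisCoord_zsmul_add v w hD, (basisCoord v w hD).injective.eq_iff]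

/-- The projection of `ℝ² × [0, 1]` onto `T² × [0, 1]` determined by a basis of the plane. -/
noncomputable def torusProj (v w : ℝ × ℝ) (hD : v.1 * w.2 - v.2 * w.1 ≠ 0)
    (p : (ℝ × ℝ) × unitInterval) :
    (AddCircle (1 : ℝ) × AddCircle (1 : ℝ)) × unitInterval :=
  Prod.map (Prod.map (fun x : ℝ => (x : AddCircle (1 : ℝ))) (fun x : ℝ => (x : AddCircle (1 : ℝ)))
    ∘ basisCoord v w hD) id p

lemma isOpenQuotientMap_torusProj (v w : ℝ × ℝ) (hD : v.1 * w.2 - v.2 * w.1 ≠ 0) :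
    IsOpenQuotientMap (torusProj v w hD) :=
  ((QuotientAddGroup.isOpenQuotientMap_mk.prodMap QuotientAddGroup.isOpenQuotientMap_mk).comp
    (basisCoord v w hD).isOpenQuotientMap).prodMap .id

lemma addCircle_coe_eq_iff (x y : ℝ) :
    (x : AddCircle (1 : ℝ)) = y ↔ ∃ i : ℤ, y - x = i := by
  rw [eq_comm, ← sub_eq_zero, ← AddCircle.coe_sub, AddCircle.coe_eq_zero_iff]
  simp [eq_comm]

lemma torusProj_eq_iff (v w : ℝ × ℝ) (hD : v.1 * w.2 - v.2 * w.1 ≠ 0)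
    (p p' : (ℝ × ℝ) × unitInterval) :
    torusProj v w hD p = torusProj v w hD p' ↔
      p'.1 - p.1 ∈ latticeSpan v w ∧ p.2 = p'.2 := by
  rw [mem_latticeSpan_iff v w hD, basisCoord_sub]
  simp only [torusProj, Prod.map, Prod.ext_iff, Function.comp_apply, id, addCircle_coe_eq_iff,
    Prod.fst_sub, Prod.snd_sub, exists_and_left, exists_and_right]

lemma nonempty_homeomorph_of_neg (l : ℝ) {m : ℝ} (hm : m < 0) {v w : ℝ × ℝ}
    (hvw : LinearIndependent ℝ ![v, w]) :
    Nonempty (Quot (orbitRel l m v w) ≃ₜ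
      (AddCircle (1 : ℝ) × AddCircle (1 : ℝ)) × unitInterval) := by
  obtain ⟨k, rfl⟩ : ∃ k, m = -k := ⟨-m, (neg_neg m).symm⟩
  have hk : 0 < k := by linarith
  have hD := det_ne_zero_of_linearIndependent hvw
  have hF : IsOpenQuotientMap (torusProj v w hD ∘ (regionHomeomorph l hk).symm) :=
    (isOpenQuotientMap_torusProj v w hD).comp (regionHomeomorph l hk).symm.isOpenQuotientMap
  let F : C(region, (AddCircle (1 : ℝ) × AddCircle (1 : ℝ)) × unitInterval) :=
    ⟨_, hF.continuous⟩
  have hrel : orbitRel l (-k) v w = (Setoid.ker F).r := by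
    ext u u'
    obtain ⟨p, rfl⟩ := (regionHomeomorph l hk).surjective u
    obtain ⟨p', rfl⟩ := (regionHomeomorph l hk).surjective u'
    change _ ↔ torusProj v w hD ((regionHomeomorph l hk).symm (regionHomeomorph l hk p)) =
      torusProj v w hD ((regionHomeomorph l hk).symm (regionHomeomorph l hk p'))
    simp only [Homeomorph.symm_apply_apply, torusProj_eq_iff, orbitRel,
      planeAct_regionHomeomorph]
    constructor
    · rintro ⟨q, hq, h⟩
      have := (regionHomeomorph l hk).injective (Subtype.ext h)
      rw [← this]
      exact ⟨by simpa using hq, rfl⟩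
    · rintro ⟨h1, h2⟩
      exact ⟨_, h1, by rw [sub_add_cancel, h2]⟩
  rw [hrel]
  exact ⟨IsQuotientMap.homeomorph (f := F) hF.isQuotientMap⟩

lemma exists_lattice_tendsto_sub {v w : ℝ × ℝ} (hvw : LinearIndependent ℝ ![v, w])
    (p : ℕ → ℝ × ℝ) :
    ∃ (q : ℕ → ℝ × ℝ) (c : ℝ × ℝ) (φ : ℕ → ℕ), StrictMono φ ∧ (∀ n, q n ∈ latticeSpan v w) ∧
      Tendsto (fun n => q n - p (φ n)) atTop (𝓝 c) := by
  have hD := det_ne_zero_of_linearIndependent hvw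
  let B := basisCoord v w hD
  let d : ℕ → ℝ × ℝ := fun n => (-Int.fract (B (p n)).1, -Int.fract (B (p n)).2)
  have hd : ∀ n, d n ∈ Set.Icc (-1 : ℝ) 0 ×ˢ Set.Icc (-1 : ℝ) 0 := fun n =>
    ⟨⟨neg_le_neg (Int.fract_lt_one _).le, neg_nonpos.2 (Int.fract_nonneg _)⟩,
      ⟨neg_le_neg (Int.fract_lt_one _).le, neg_nonpos.2 (Int.fract_nonneg _)⟩⟩
  obtain ⟨c, -, φ, hφ, hc⟩ := (isCompact_Icc.prod isCompact_Icc).tendsto_subseq hd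
  refine ⟨fun n => ⌊(B (p (φ n))).1⌋ • v + ⌊(B (p (φ n))).2⌋ • w, B.symm c, φ, hφ,
    fun n => ⟨_, _, rfl⟩, ?_⟩
  refine ((B.symm.continuous.tendsto c).comp hc).congr fun n => ?_
  apply B.injective
  rw [show B (_ - p (φ n)) = B _ - B (p (φ n)) from basisCoord_sub v w hD _ _,
    show B (⌊_⌋ • v + ⌊_⌋ • w) = _ from basisCoord_zsmul_add v w hD _ _]
  change B (B.symm (d (φ n))) = _
  rw [Homeomorph.apply_symm_apply]
  ext
  · simp only [d, Prod.fst_sub, ← Int.self_sub_floor]; ring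
  · simp only [d, Prod.snd_sub, ← Int.self_sub_floor]; ring

/-- Limits of two sequences related termwise by the lattice are related, if the quotient is
Hausdorff. -/
lemma exists_lattice_of_tendsto {l m : ℝ} {v w : ℝ × ℝ} [T2Space (Quot (orbitRel l m v w))]
    {u u' : ℕ → Fin 3 → ℝ} {z z' : Fin 3 → ℝ} (hu : ∀ n, u n ∈ region) (hz : z ∈ region)
    (hz' : z' ∈ region) (h : ∀ n, ∃ q ∈ latticeSpan v w, planeAct l m q (u n) = u' n)
    (hlim : Tendsto u atTop (𝓝 z)) (hlim' : Tendsto u' atTop (𝓝 z')) :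
    ∃ q ∈ latticeSpan v w, planeAct l m q z = z' := by
  have hu' : ∀ n, u' n ∈ region := fun n => by
    obtain ⟨q, -, hq⟩ := h n
    exact hq ▸ planeAct_mem_region l m q (hu n)
  have h1 : Tendsto (fun n => (⟨u n, hu n⟩ : region)) atTop (𝓝 ⟨z, hz⟩) :=
    tendsto_subtype_rng.2 hlim
  have h2 : Tendsto (fun n => (⟨u' n, hu' n⟩ : region)) atTop (𝓝 ⟨z', hz'⟩) :=
    tendsto_subtype_rng.2 hlim'
  have hmk : Continuous (Quot.mk (orbitRel l m v w)) := continuous_quot_mk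
  have e1 := (hmk.tendsto _).comp h1
  have e2 := (hmk.tendsto _).comp h2
  have e : (Quot.mk (orbitRel l m v w) ∘ fun n => (⟨u n, hu n⟩ : region)) =
      Quot.mk (orbitRel l m v w) ∘ fun n => (⟨u' n, hu' n⟩ : region) :=
    funext fun n => Quot.sound (h n)
  rw [e] at e1
  exact ((equivalence_orbitRel l m v w).quot_mk_eq_iff _ _).1 (tendsto_nhds_unique e1 e2)

lemma not_t2Space_of_pos (l : ℝ) {m : ℝ} (hm : 0 < m) {v w : ℝ × ℝ}
    (hvw : LinearIndependent ℝ ![v, w]) : ¬ T2Space (Quot (orbitRel l m v w)) := by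
  intro _
  obtain ⟨q, c, φ, hφ, hq, hc⟩ := exists_lattice_tendsto_sub hvw
    fun n => (log ((n : ℝ) + 1), -((n : ℝ) + 1))
  set N : ℕ → ℝ := fun n => (φ n : ℝ) + 1 with hN
  have hNpos : ∀ n, 0 < N n := fun n => by positivity
  have hNlim : Tendsto N atTop atTop :=
    tendsto_atTop_add_const_right _ _ (tendsto_natCast_atTop_atTop.comp hφ.tendsto_atTop)
  have hNinv : Tendsto (fun n => (N n)⁻¹) atTop (𝓝 0) := tendsto_inv_atTop_zero.comp hNlim
  have ha : Tendsto (fun n => (q n).1 - log (N n)) atTop (𝓝 c.1) :=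
    (continuous_fst.tendsto c).comp hc
  have hb : Tendsto (fun n => (q n).2 + N n) atTop (𝓝 c.2) :=
    ((continuous_snd.tendsto c).comp hc).congr fun n => by
      simp only [Function.comp_apply, Prod.snd_sub, hN]; ring
  have hexp : ∀ n, exp (q n).1 = exp ((q n).1 - log (N n)) * N n := fun n => by
    rw [exp_sub, exp_log (hNpos n), div_mul_cancel₀ _ (hNpos n).ne']
  have hb' : Tendsto (fun n => (q n).2 * (N n)⁻¹) atTop (𝓝 (-1)) := by
    have : Tendsto (fun n => ((q n).2 + N n) * (N n)⁻¹ - 1) atTop (𝓝 (c.2 * 0 - 1)) :=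
      (hb.mul hNinv).sub_const 1
    refine (by simpa using this : Tendsto _ _ (𝓝 (-1 : ℝ))).congr fun n => ?_
    have := (hNpos n).ne'
    field_simp
    ring
  have hdecay : Tendsto (fun n => l * (q n).1 + m * (q n).2) atTop atBot := by
    have hlog : Tendsto (fun n => log (N n) * (N n)⁻¹) atTop (𝓝 0) := by
      have := (isLittleO_log_id_atTop.tendsto_div_nhds_zero).comp hNlim
      refine this.congr fun n => ?_
      simp [div_eq_mul_inv]
    have h1 : Tendsto (fun n => l * (log (N n) * (N n)⁻¹) - m) atTop (𝓝 (l * 0 - m)) :=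
      (hlog.const_mul l).sub_const m
    have h2 : Tendsto (fun n => (l * (log (N n) * (N n)⁻¹) - m) * N n) atTop atBot :=
      h1.neg_mul_atTop (by linarith) hNlim
    have h3 := (ha.const_mul l).add (hb.const_mul m)
    refine (h2.atBot_add h3).congr fun n => ?_
    have := (hNpos n).ne'
    field_simp
    ring
  obtain ⟨r, -, hr⟩ := exists_lattice_of_tendsto (l := l) (m := m) (v := v) (w := w)
    (u := fun n => ![-((q n).2 * (N n)⁻¹), (N n)⁻¹, 1])
    (u' := fun n => ![0, exp ((q n).1 - log (N n)), exp (l * (q n).1 + m * (q n).2)])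
    (z := ![1, 0, 1]) (z' := ![0, exp c.1, 0])
    (fun n => Or.inl (Or.inl ⟨by simpa using hNpos n, by simp⟩))
    (Or.inl (Or.inr ⟨by simp, by simp, by simp⟩))
    (Or.inr ⟨by simp [exp_pos], by simp⟩)
    (fun n => ⟨q n, hq n, by
      ext i
      fin_cases i
      · simp [planeAct]
      · simp [planeAct, hexp, (hNpos n).ne']
      · simp [planeAct]⟩)
    (tendsto_pi_nhds.2 fun i => by
      fin_cases i
      · simpa using hb'.neg
      · simpa using hNinv
      · simp)
    (tendsto_pi_nhds.2 fun i => by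
      fin_cases i
      · simp
      · exact (continuous_exp.tendsto _).comp ha
      · exact tendsto_exp_atBot.comp hdecay)
  have := congrFun hr 2
  simp [planeAct] at this

lemma not_t2Space_of_zero (l : ℝ) {v w : ℝ × ℝ}
    (hvw : LinearIndependent ℝ ![v, w]) : ¬ T2Space (Quot (orbitRel l 0 v w)) := by
  intro _
  obtain ⟨q, c, φ, hφ, hq, hc⟩ := exists_lattice_tendsto_sub hvw fun n => (0, (n : ℝ))
  have ha : Tendsto (fun n => (q n).1) atTop (𝓝 c.1) :=
    ((continuous_fst.tendsto c).comp hc).congr fun n => by simp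
  have hb : Tendsto (fun n => (q n).2) atTop atTop := by
    have h1 : Tendsto (fun n => (q n).2 - (φ n : ℝ)) atTop (𝓝 c.2) :=
      (continuous_snd.tendsto c).comp hc
    refine (h1.add_atTop (tendsto_natCast_atTop_atTop.comp hφ.tendsto_atTop)).congr fun n => ?_
    simp
  obtain ⟨n₀, hn₀⟩ := eventually_atTop.1 (hb.eventually_gt_atTop 0)
  have hpos : ∀ n, 0 < (q (n + n₀)).2 := fun n => hn₀ _ (Nat.le_add_left _ _)
  have ha' : Tendsto (fun n => (q (n + n₀)).1) atTop (𝓝 c.1) := (tendsto_add_atTop_iff_nat n₀).2 ha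
  have hb' : Tendsto (fun n => ((q (n + n₀)).2)⁻¹) atTop (𝓝 0) :=
    tendsto_inv_atTop_zero.comp ((tendsto_add_atTop_iff_nat n₀).2 hb)
  have key : Set.Ioo (1 : ℝ) 2 ⊆
      Set.range fun ij : ℤ × ℤ => exp (ij.1 • v + ij.2 • w).1 / exp c.1 := by
    intro x hx
    have hx0 : 0 < x - 1 := by linarith [hx.1]
    obtain ⟨r, ⟨i, j, rfl⟩, hr⟩ := exists_lattice_of_tendsto (l := l) (m := 0) (v := v) (w := w)
      (u := fun n => ![1, (x - 1) * ((q (n + n₀)).2)⁻¹, 1])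
      (u' := fun n => ![exp (q (n + n₀)).1 * x, exp (q (n + n₀)).1 *
        ((x - 1) * ((q (n + n₀)).2)⁻¹), exp (l * (q (n + n₀)).1)])
      (z := ![1, 0, 1]) (z' := ![exp c.1 * x, exp c.1 * ((x - 1) * 0), exp (l * c.1)])
      (fun n => Or.inl (Or.inl ⟨mul_pos hx0 (inv_pos.2 (hpos n)), by simp⟩))
      (Or.inl (Or.inr ⟨by simp, by simp, by simp⟩))
      (Or.inl (Or.inr ⟨mul_pos (exp_pos _) (by linarith), by simp, exp_pos _⟩))
      (fun n => ⟨q (n + n₀), hq _, by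
        have := (hpos n).ne'
        ext i
        fin_cases i
        · simp [planeAct]; field_simp; ring
        · simp [planeAct]
        · simp [planeAct]⟩)
      (tendsto_pi_nhds.2 fun i => by
        fin_cases i
        · simp
        · simpa using hb'.const_mul (x - 1)
        · simp)
      (tendsto_pi_nhds.2 fun i => by
        fin_cases i
        · exact (((continuous_exp.tendsto _).comp ha').mul_const x)
        · exact (((continuous_exp.tendsto _).comp ha').mul (hb'.const_mul (x - 1)))
        · exact (continuous_exp.tendsto _).comp (ha'.const_mul l))
    refine ⟨(i, j), ?_⟩
    have h0 := congrFun hr 0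
    simp only [planeAct, Matrix.cons_val_zero, Matrix.cons_val_one, mul_zero, add_zero,
      mul_one] at h0
    simp only [h0]
    exact mul_div_cancel_left₀ _ (exp_pos _).ne'
  have hcount := (Set.countable_range _).mono key
  rw [Cardinal.Real.Ioo_countable_iff] at hcount
  norm_num at hcount

/-- Lemma C.10 (lem:positivity): `(a,b) ↦ M(a,b)` with
`M(a,b) = [[eᵃ, b·eᵃ, 0], [0, eᵃ, 0], [0, 0, e^{la+mb}]]` is an injective homomorphism from
`(ℝ², +)` into the invertible 3×3 matrices; the set `U` is invariant under every `M(a,b)`;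
and for a lattice `Λ ⊆ ℝ²` the quotient of `U` by the `Λ`-action is homeomorphic to
`T² × [0,1]` if and only if `m < 0`. -/
theorem stmt8 (l m : ℝ)
    (M : ℝ × ℝ → Matrix (Fin 3) (Fin 3) ℝ)
    (hM : ∀ q : ℝ × ℝ, M q =
      !![Real.exp q.1, q.2 * Real.exp q.1, 0;
         0, Real.exp q.1, 0;
         0, 0, Real.exp (l * q.1 + m * q.2)])
    (v w : ℝ × ℝ) (hvw : LinearIndependent ℝ ![v, w])
    (Λ : Set (ℝ × ℝ)) (hΛ : Λ = {q : ℝ × ℝ | ∃ i j : ℤ, q = i • v + j • w})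
    (U : Set (Fin 3 → ℝ))
    (hU : U = {z : Fin 3 → ℝ | 0 < z 1 ∧ 0 < z 2} ∪
      {z : Fin 3 → ℝ | 0 < z 0 ∧ z 1 = 0 ∧ 0 < z 2} ∪
      {z : Fin 3 → ℝ | 0 < z 1 ∧ z 2 = 0}) :
    (∀ q q' : ℝ × ℝ, M (q + q') = M q * M q') ∧
    Function.Injective M ∧
    (∀ q : ℝ × ℝ, IsUnit (M q)) ∧
    (∀ q : ℝ × ℝ, ∀ z ∈ U, (M q).mulVec z ∈ U) ∧
    ((Nonempty ((Quot fun z z' : U => ∃ q ∈ Λ, (M q).mulVec (z : Fin 3 → ℝ) = (z' : Fin 3 → ℝ)) ≃ₜ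
        (AddCircle (1 : ℝ) × AddCircle (1 : ℝ)) × unitInterval)) ↔ m < 0) := by
  have hact : ∀ (q : ℝ × ℝ) (z : Fin 3 → ℝ), (M q).mulVec z = planeAct l m q z := fun q z => by
    rw [hM]
    ext i
    fin_cases i <;> simp [planeAct, Matrix.mulVec, dotProduct, Fin.sum_univ_three]
    ring
  have hadd : ∀ q q' : ℝ × ℝ, M (q + q') = M q * M q' := fun q q' =>
    Matrix.ext_of_mulVec_single fun i => by
      rw [← Matrix.mulVec_mulVec, hact, hact, hact, planeAct_add]
  have hone : M 0 = 1 :=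
    Matrix.ext_of_mulVec_single fun i => by rw [hact, planeAct_zero, Matrix.one_mulVec]
  have hUr : U = region := hU
  subst hUr
  refine ⟨hadd, ?_, ?_, ?_, ?_⟩
  · intro q q' h
    have h0 := congrFun (congrFun h 0) 0
    have h1 := congrFun (congrFun h 0) 1
    simp only [hM, Matrix.of_apply, Matrix.cons_val_zero, Matrix.cons_val_one] at h0 h1
    rw [h0] at h1
    exact Prod.ext (exp_injective h0) (mul_right_cancel₀ (exp_pos _).ne' h1)
  · intro q
    refine IsUnit.of_mul_eq_one (M (-q)) ?_
    rw [← hadd, add_neg_cancel, hone]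
  · intro q z hz
    rw [hact]
    exact planeAct_mem_region l m q hz
  · have hrel : (fun z z' : region => ∃ q ∈ Λ, (M q).mulVec (z : Fin 3 → ℝ) = (z' : Fin 3 → ℝ)) =
        orbitRel l m v w := by
      ext z z'
      simp only [hact, hΛ]
      rfl
    rw [hrel]
    refine ⟨fun ⟨h⟩ => ?_, fun hm => nonempty_homeomorph_of_neg l hm hvw⟩
    have hT2 : T2Space (Quot (orbitRel l m v w)) := h.symm.t2Space
    rcases lt_trichotomy m 0 with hm | rfl | hm
    · exact hm
    · exact absurd hT2 (not_t2Space_of_zero l hvw)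
    · exact absurd hT2 (not_t2Space_of_pos l hm hvw)
end

section
/- Let θ, π ∈ GL(3, ℝ) be the matrices θ with rows (e², e², 0), (0, e², 0), (0, 0, e⁻⁴) and π with rows (e³, −e³, 0), (0, e³, 0), (0, 0, e³), and let U = {(x,y,z) ∈ ℝ³ : y > 0, z > 0} ∪ {(x,y,z) : x > 0, y = 0, z > 0} ∪ {(x,y,z) : y > 0, z = 0}. Then θ and π commute, both preserve U, and the subgroup ⟨θ, π⟩ of GL(3, ℝ) acts freely and properly discontinuously on U. -/
open Matrix

/-- The two-parameter family of matrices containing the group generated by `θ` and `ρ`: it scales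
the first two coordinates by `exp s`, shears them by `k`, and scales the last coordinate so that
`5 * log z + log y + 18 * x / y` is invariant. -/
noncomputable def scaledShear (s k : ℝ) : Matrix (Fin 3) (Fin 3) ℝ :=
  !![Real.exp s, k * Real.exp s, 0; 0, Real.exp s, 0; 0, 0, Real.exp (-(s + 18 * k) / 5)]

/-- The domain on which the group acts. -/
def shearDomain : Set (Fin 3 → ℝ) :=
  {z : Fin 3 → ℝ | 0 < z 1 ∧ 0 < z 2} ∪ {z : Fin 3 → ℝ | 0 < z 0 ∧ z 1 = 0 ∧ 0 < z 2} ∪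
    {z : Fin 3 → ℝ | 0 < z 1 ∧ z 2 = 0}

theorem scaledShear_zero : scaledShear 0 0 = 1 := by
  ext i j
  fin_cases i <;> fin_cases j <;> simp [scaledShear]

theorem scaledShear_mul (s k s' k' : ℝ) :
    scaledShear s k * scaledShear s' k' = scaledShear (s + s') (k + k') := by
  have h : -(s + s' + 18 * (k + k')) / 5 = -(s + 18 * k) / 5 + -(s' + 18 * k') / 5 := by ring
  ext i j
  fin_cases i <;> fin_cases j <;>
    simp [scaledShear, Matrix.mul_apply, Fin.sum_univ_three, h, Real.exp_add, -neg_add_rev] <;> ring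

theorem scaledShear_neg_mulVec {s k : ℝ} {v w : Fin 3 → ℝ} (h : scaledShear s k *ᵥ v = w) :
    scaledShear (-s) (-k) *ᵥ w = v := by
  rw [← h, Matrix.mulVec_mulVec, scaledShear_mul]
  simp [scaledShear_zero]

theorem scaledShear_mulVec_apply_zero (s k : ℝ) (v : Fin 3 → ℝ) :
    (scaledShear s k *ᵥ v) 0 = Real.exp s * (v 0 + k * v 1) := by
  simp [scaledShear, Matrix.mulVec, dotProduct, Fin.sum_univ_three]
  ring

theorem scaledShear_mulVec_apply_one (s k : ℝ) (v : Fin 3 → ℝ) :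
    (scaledShear s k *ᵥ v) 1 = Real.exp s * v 1 := by
  simp [scaledShear, Matrix.mulVec, dotProduct, Fin.sum_univ_three]

theorem scaledShear_mulVec_apply_two (s k : ℝ) (v : Fin 3 → ℝ) :
    (scaledShear s k *ᵥ v) 2 = Real.exp (-(s + 18 * k) / 5) * v 2 := by
  simp [scaledShear, Matrix.mulVec, dotProduct, Fin.sum_univ_three]

theorem scaledShear_mulVec_mem {v : Fin 3 → ℝ} (hv : v ∈ shearDomain) (s k : ℝ) :
    scaledShear s k *ᵥ v ∈ shearDomain := by
  have hs := Real.exp_pos s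
  have ht := Real.exp_pos (-(s + 18 * k) / 5)
  simp only [shearDomain, Set.mem_union, Set.mem_ofPred_eq, scaledShear_mulVec_apply_zero,
    scaledShear_mulVec_apply_one, scaledShear_mulVec_apply_two] at hv ⊢
  rcases hv with (⟨h1, h2⟩ | ⟨h0, h1, h2⟩) | ⟨h1, h2⟩
  · exact .inl (.inl ⟨mul_pos hs h1, mul_pos ht h2⟩)
  · exact .inl (.inr ⟨by simp [h1, hs, h0], by simp [h1], mul_pos ht h2⟩)
  · exact .inr ⟨mul_pos hs h1, by simp [h2]⟩

theorem eq_zero_of_scaledShear_mulVec_eq {v : Fin 3 → ℝ} (hv : v ∈ shearDomain) {s k : ℝ}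
    (h : scaledShear s k *ᵥ v = v) : s = 0 ∧ k = 0 := by
  have e0 := congrFun h 0
  have e1 := congrFun h 1
  have e2 := congrFun h 2
  rw [scaledShear_mulVec_apply_zero] at e0
  rw [scaledShear_mulVec_apply_one] at e1
  rw [scaledShear_mulVec_apply_two] at e2
  have of_pos (h1 : 0 < v 1) : s = 0 ∧ k = 0 := by
    have hs : s = 0 := by
      rw [← Real.exp_eq_one_iff]
      exact (mul_eq_right₀ h1.ne').1 e1
    refine ⟨hs, ?_⟩
    subst hs
    simpa [h1.ne'] using e0
  rcases hv with (⟨h1, -⟩ | ⟨h0, h1, h2⟩) | ⟨h1, -⟩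
  · exact of_pos h1
  · simp only [h1, mul_zero, add_zero] at e0
    have hs : s = 0 := by
      rw [← Real.exp_eq_one_iff]
      exact (mul_eq_right₀ h0.ne').1 e0
    have ht : -(s + 18 * k) / 5 = 0 := by
      rw [← Real.exp_eq_one_iff]
      exact (mul_eq_right₀ h2.ne').1 e2
    exact ⟨hs, by linarith⟩
  · exact of_pos h1

/-- The points of norm at most `C` which stay at distance about `δ` from the boundary of
`shearDomain`. -/
def shearCore (C δ : ℝ) : Set (Fin 3 → ℝ) :=
  {v | (∀ i, |v i| ≤ C) ∧ 0 ≤ v 1 ∧ (δ ≤ v 1 ∨ δ ≤ v 0 ∧ δ ≤ v 2)}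

theorem exists_subset_shearCore {S : Set (Fin 3 → ℝ)} (hS : IsCompact S)
    (hSU : S ⊆ shearDomain) : ∃ C δ : ℝ, 0 < C ∧ 0 < δ ∧ S ⊆ shearCore C δ := by
  obtain ⟨C, hC, hCS⟩ := hS.isBounded.exists_pos_norm_le
  have hpos : ∀ v ∈ S, 0 < max (v 1) (min (v 0) (v 2)) := by
    intro v hv
    rcases hSU hv with (⟨h1, -⟩ | ⟨h0, -, h2⟩) | ⟨h1, -⟩
    · exact lt_max_of_lt_left h1
    · exact lt_max_of_lt_right (lt_min h0 h2)
    · exact lt_max_of_lt_left h1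
  obtain ⟨δ, hδ, hδS⟩ := hS.exists_forall_le' (a := (0 : ℝ))
    (f := fun v => max (v 1) (min (v 0) (v 2))) (by fun_prop) hpos
  refine ⟨C, δ, hC, hδ, fun v hv => ⟨fun i => ?_, ?_, ?_⟩⟩
  · exact (norm_le_pi_norm v i).trans (hCS v hv)
  · rcases hSU hv with (⟨h1, -⟩ | ⟨-, h1, -⟩) | ⟨h1, -⟩
    exacts [h1.le, h1.ge, h1.le]
  · simpa using hδS v hv

theorem le_div_of_exp_mul_le {r x C δ : ℝ} (hδ : 0 < δ) (hx : δ ≤ x)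
    (h : Real.exp r * x ≤ C) : r ≤ C / δ := by
  rw [le_div_iff₀ hδ]
  nlinarith [Real.add_one_le_exp r, Real.exp_pos r]

theorem neg_le_of_scaledShear_mulVec_mem {C δ : ℝ} (hδ : 0 < δ) {s k : ℝ}
    {v : Fin 3 → ℝ} (h2 : δ ≤ v 2) (hw : scaledShear s k *ᵥ v ∈ shearCore C δ) :
    -k ≤ (s + 5 * (C / δ)) / 18 := by
  have w2 := (abs_le.1 (hw.1 2)).2
  rw [scaledShear_mulVec_apply_two] at w2
  linarith [le_div_of_exp_mul_le hδ h2 w2]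

theorem scale_le_of_mem_shearCore {C δ : ℝ} (hC : 0 < C) (hδ : 0 < δ) {s k : ℝ}
    {v : Fin 3 → ℝ} (hv : v ∈ shearCore C δ) (hw : scaledShear s k *ᵥ v ∈ shearCore C δ) :
    s ≤ 10 * (C / δ) + 10 := by
  have hD : 0 < C / δ := div_pos hC hδ
  have w0 := (abs_le.1 (hw.1 0)).2
  have w1 := (abs_le.1 (hw.1 1)).2
  have w1' := hw.2.1
  rcases hv.2.2 with h1 | ⟨h0, h2⟩
  · rw [scaledShear_mulVec_apply_one] at w1
    linarith [le_div_of_exp_mul_le hδ h1 w1]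
  · by_contra! hs
    have hk := neg_le_of_scaledShear_mulVec_mem hδ h2 hw
    have hs0 : 0 < s := by linarith
    have hx : Real.exp s * v 0 = (scaledShear s k *ᵥ v) 0 - k * (scaledShear s k *ᵥ v) 1 := by
      rw [scaledShear_mulVec_apply_zero, scaledShear_mulVec_apply_one]
      ring
    have hky : -k * (scaledShear s k *ᵥ v) 1 ≤ (s + 5 * (C / δ)) / 18 * C :=
      mul_le_mul hk w1 w1' (by positivity)
    have hexp : Real.exp s ≤ C / δ + (s + 5 * (C / δ)) / 18 * (C / δ) := by
      have : Real.exp s * δ ≤ C + (s + 5 * (C / δ)) / 18 * C := by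
        nlinarith [Real.exp_pos s]
      rw [← le_div_iff₀ hδ] at this
      exact this.trans_eq (by ring)
    have hquad := Real.quadratic_le_exp_of_nonneg hs0.le
    nlinarith

theorem exists_bound_of_mem_shearCore {C δ : ℝ} (hC : 0 < C) (hδ : 0 < δ) :
    ∃ B : ℝ, ∀ s k : ℝ, ∀ v ∈ shearCore C δ, scaledShear s k *ᵥ v ∈ shearCore C δ →
      |s| ≤ B ∧ |k| ≤ B := by
  set A := 10 * (C / δ) + 10
  have hA : 0 < A := by positivity
  set B := A + 5 * (C / δ) + (Real.exp A * C + C) / δ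
  have hD : 0 < C / δ := div_pos hC hδ
  have hE : 0 < (Real.exp A * C + C) / δ := by positivity
  have key : ∀ s k : ℝ, ∀ v ∈ shearCore C δ, scaledShear s k *ᵥ v ∈ shearCore C δ →
      |s| ≤ A → -k ≤ B := by
    intro s k v hv hw hs
    rcases hv.2.2 with h1 | ⟨-, h2⟩
    · have hy : -k * v 1 ≤ Real.exp A * C + C := by
        have e : -k * v 1 = v 0 - Real.exp (-s) * (scaledShear s k *ᵥ v) 0 := by
          rw [scaledShear_mulVec_apply_zero, ← mul_assoc, ← Real.exp_add]
          simp
        have hexp : Real.exp (-s) ≤ Real.exp A :=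
          Real.exp_le_exp.2 (by linarith [(abs_le.1 hs).1])
        have w0 := (abs_le.1 (hw.1 0)).1
        have v0 := (abs_le.1 (hv.1 0)).2
        rw [e]
        nlinarith [Real.exp_pos (-s)]
      have : -k ≤ (Real.exp A * C + C) / δ := by
        rw [le_div_iff₀ hδ]
        by_cases hk : 0 ≤ -k
        · exact (mul_le_mul_of_nonneg_left h1 hk).trans hy
        · have : 0 < Real.exp A * C + C := by positivity
          nlinarith
      linarith
    · have := neg_le_of_scaledShear_mulVec_mem hδ h2 hw
      linarith [(abs_le.1 hs).2]
  refine ⟨B, fun s k v hv hw => ?_⟩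
  have hv' : scaledShear (-s) (-k) *ᵥ (scaledShear s k *ᵥ v) ∈ shearCore C δ := by
    rwa [scaledShear_neg_mulVec rfl]
  have hs : |s| ≤ A := abs_le'.2
    ⟨scale_le_of_mem_shearCore hC hδ hv hw, scale_le_of_mem_shearCore hC hδ hw hv'⟩
  refine ⟨by linarith, abs_le'.2 ⟨?_, key s k v hv hw hs⟩⟩
  simpa using key (-s) (-k) _ hw hv' (by rwa [abs_neg])

theorem finite_setOf_abs_le (B : ℝ) :
    {p : ℤ × ℤ | |(2 * p.1 + 3 * p.2 : ℝ)| ≤ B ∧ |(p.1 - p.2 : ℝ)| ≤ B}.Finite := by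
  refine ((Set.finite_Icc (-⌈2 * B⌉) ⌈2 * B⌉).prod
    (Set.finite_Icc (-⌈2 * B⌉) ⌈2 * B⌉)).subset ?_
  rintro ⟨a, b⟩ ⟨hs, hk⟩
  have hc := Int.le_ceil (2 * B)
  rw [abs_le] at hs hk
  simp only [Set.mem_prod, Set.mem_Icc]
  refine ⟨⟨?_, ?_⟩, ?_, ?_⟩ <;> rify <;> linarith

theorem exists_eq_scaledShear_of_mem_closure {θ ρ : GL (Fin 3) ℝ}
    (hθ : (θ : Matrix (Fin 3) (Fin 3) ℝ) = scaledShear 2 1)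
    (hρ : (ρ : Matrix (Fin 3) (Fin 3) ℝ) = scaledShear 3 (-1))
    {g : GL (Fin 3) ℝ} (hg : g ∈ Subgroup.closure {θ, ρ}) :
    ∃ a b : ℤ, (g : Matrix (Fin 3) (Fin 3) ℝ) = scaledShear (2 * a + 3 * b) (a - b) := by
  induction hg using Subgroup.closure_induction with
  | mem x hx =>
    rcases hx with rfl | rfl
    · exact ⟨1, 0, by simpa using hθ⟩
    · exact ⟨0, 1, by simpa using hρ⟩
  | one => exact ⟨0, 0, by simp [scaledShear_zero]⟩
  | mul x y _ _ hx hy =>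
    obtain ⟨a, b, hx⟩ := hx
    obtain ⟨c, d, hy⟩ := hy
    refine ⟨a + c, b + d, ?_⟩
    rw [Units.val_mul, hx, hy, scaledShear_mul]
    push_cast
    congr 1 <;> ring
  | inv x _ hx =>
    obtain ⟨a, b, hx⟩ := hx
    refine ⟨-a, -b, ?_⟩
    rw [Matrix.coe_units_inv, hx]
    refine Matrix.inv_eq_right_inv ?_
    rw [scaledShear_mul, ← scaledShear_zero]
    push_cast
    congr 1 <;> ring

/-- The Example of Appendix C: the matrices `θ = diag-block(e²·[[1,1],[0,1]], e⁻⁴)` and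
`ρ = e³·[[1,−1],[0,1]] ⊕ e³` commute, the subgroup `⟨θ, ρ⟩` of `GL(3, ℝ)` preserves the set
`U`, and it acts freely and properly discontinuously on `U`. -/
theorem stmt10 (θ ρ : GL (Fin 3) ℝ)
    (hθ : (θ : Matrix (Fin 3) (Fin 3) ℝ) =
      !![Real.exp 2, Real.exp 2, 0; 0, Real.exp 2, 0; 0, 0, Real.exp (-4)])
    (hρ : (ρ : Matrix (Fin 3) (Fin 3) ℝ) =
      !![Real.exp 3, -Real.exp 3, 0; 0, Real.exp 3, 0; 0, 0, Real.exp 3])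
    (U : Set (Fin 3 → ℝ))
    (hU : U = {z : Fin 3 → ℝ | 0 < z 1 ∧ 0 < z 2} ∪
      {z : Fin 3 → ℝ | 0 < z 0 ∧ z 1 = 0 ∧ 0 < z 2} ∪
      {z : Fin 3 → ℝ | 0 < z 1 ∧ z 2 = 0}) :
    θ * ρ = ρ * θ ∧
    (∀ g ∈ Subgroup.closure {θ, ρ}, ∀ z ∈ U,
      ((g : GL (Fin 3) ℝ) : Matrix (Fin 3) (Fin 3) ℝ).mulVec z ∈ U) ∧
    (∀ g ∈ Subgroup.closure {θ, ρ}, ∀ z ∈ U,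
      ((g : GL (Fin 3) ℝ) : Matrix (Fin 3) (Fin 3) ℝ).mulVec z = z → g = 1) ∧
    (∀ K L : Set (Fin 3 → ℝ), K ⊆ U → L ⊆ U → IsCompact K → IsCompact L →
      {g : GL (Fin 3) ℝ | g ∈ Subgroup.closure {θ, ρ} ∧
        (((g : Matrix (Fin 3) (Fin 3) ℝ).mulVec '' K) ∩ L).Nonempty}.Finite) := by
  have hθ' : (θ : Matrix (Fin 3) (Fin 3) ℝ) = scaledShear 2 1 := by
    rw [hθ, scaledShear]
    norm_num
  have hρ' : (ρ : Matrix (Fin 3) (Fin 3) ℝ) = scaledShear 3 (-1) := by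
    rw [hρ, scaledShear]
    norm_num
  change U = shearDomain at hU
  subst hU
  refine ⟨?_, ?_, ?_, ?_⟩
  · apply Units.ext
    rw [Units.val_mul, Units.val_mul, hθ', hρ', scaledShear_mul, scaledShear_mul, add_comm 2,
      add_comm 1]
  · intro g hg z hz
    obtain ⟨a, b, h⟩ := exists_eq_scaledShear_of_mem_closure hθ' hρ' hg
    rw [h]
    exact scaledShear_mulVec_mem hz _ _
  · intro g hg z hz hgz
    obtain ⟨a, b, h⟩ := exists_eq_scaledShear_of_mem_closure hθ' hρ' hg
    rw [h] at hgz
    obtain ⟨hs, hk⟩ := eq_zero_of_scaledShear_mulVec_eq hz hgz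
    apply Units.ext
    rw [h, hs, hk, scaledShear_zero, Units.val_one]
  · intro K L hKU hLU hK hL
    obtain ⟨C, δ, hC, hδ, hcore⟩ :=
      exists_subset_shearCore (hK.union hL) (Set.union_subset hKU hLU)
    obtain ⟨B, hB⟩ := exists_bound_of_mem_shearCore hC hδ
    refine Set.Finite.subset (((finite_setOf_abs_le B).image fun p : ℤ × ℤ =>
      scaledShear (2 * p.1 + 3 * p.2) (p.1 - p.2)).preimage Units.val_injective.injOn) ?_
    rintro g ⟨hg, w, ⟨v, hv, rfl⟩, hw⟩
    obtain ⟨a, b, h⟩ := exists_eq_scaledShear_of_mem_closure hθ' hρ' hg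
    rw [h] at hw
    exact ⟨(a, b), hB _ _ v (hcore (.inl hv)) (hcore (.inr hw)), h.symm⟩
end

section
/- Let H_P ⊆ GL(3, ℝ) be the set of matrices M(a,b,c) with rows (e^a, b·e^a, 0), (0, e^a, 0), (0, 0, e^c) for a, b, c ∈ ℝ; H_P is a subgroup, with M(a,b,c)·M(a′,b′,c′) = M(a+a′, b+b′, c+c′). Acting on the unit sphere S² ⊆ ℝ³ by A • v = Av/‖Av‖, the orbits of H_P are exactly: the four points ±e₁, ±e₃; the four open arcs that are the connected components of the great circle S² ∩ {v : v₂ = 0} with the four points ±e₁, ±e₃ removed; the two open half-circles that are the connected components of the great circle S² ∩ {v : v₃ = 0} with the two points ±e₁ removed; and the four open lunes S² ∩ {v : ε v₂ > 0, δ v₃ > 0} for ε, δ ∈ {1, −1}. -/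
/-- The unit sphere `S²` in `ℝ³` (Euclidean norm). -/
def sphere2 : Set (Fin 3 → ℝ) := {v | ∑ i, v i ^ 2 = 1}

/-- `± eᵢ`: the vector with `ε` in coordinate `i` and `0` elsewhere. -/
def unitVec (i : Fin 3) (ε : ℝ) : Fin 3 → ℝ := fun j => if j = i then ε else 0

/-- The projective action of an (invertible) matrix `A` on the sphere of directions:
`v ↦ A v / ‖A v‖`. -/
noncomputable def projAct (A : Matrix (Fin 3) (Fin 3) ℝ) (v : Fin 3 → ℝ) : Fin 3 → ℝ :=
  (Real.sqrt (∑ i, (A.mulVec v) i ^ 2))⁻¹ • A.mulVec v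

/-- The orbit of `v` under a set `H` of matrices acting projectively on the sphere. -/
noncomputable def sorbit (H : Set (Matrix (Fin 3) (Fin 3) ℝ)) (v : Fin 3 → ℝ) :
    Set (Fin 3 → ℝ) := {w | ∃ A ∈ H, w = projAct A v}

/-- The group `H_P` of all matrices `M(a,b,c)`. -/
def groupP : Set (Matrix (Fin 3) (Fin 3) ℝ) :=
  {A | ∃ a b c : ℝ,
    A = !![Real.exp a, b * Real.exp a, 0; 0, Real.exp a, 0; 0, 0, Real.exp c]}

lemma mem_sphere2 {v : Fin 3 → ℝ} : v ∈ sphere2 ↔ v 0 ^ 2 + v 1 ^ 2 + v 2 ^ 2 = 1 := by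
  simp [sphere2, Fin.sum_univ_three]

lemma sum_sq_eq_zero {u : Fin 3 → ℝ} (h : ∑ i, u i ^ 2 = 0) : u = 0 := by
  funext i
  have := (Finset.sum_eq_zero_iff_of_nonneg fun i _ => sq_nonneg (u i)).1 h i (Finset.mem_univ i)
  simpa using this

lemma div_pos_of_mul_pos {ε x y : ℝ} (hx : 0 < ε * x) (hy : 0 < ε * y) : 0 < x / y := by
  have hε : ε ≠ 0 := left_ne_zero_of_mul hx.ne'
  rw [← mul_div_mul_left x y hε]
  exact div_pos hx hy

lemma exists_sign {x : ℝ} (hx : x ≠ 0) : ∃ ε : ℝ, (ε = 1 ∨ ε = -1) ∧ 0 < ε * x := by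
  rcases hx.lt_or_gt with h | h
  · exact ⟨-1, Or.inr rfl, by linarith⟩
  · exact ⟨1, Or.inl rfl, by linarith⟩

lemma mul_self_eq_one_of_sign {ε : ℝ} (hε : ε = 1 ∨ ε = -1) : ε * ε = 1 := by
  rcases hε with rfl | rfl <;> norm_num

/-- The orbit of a point of the sphere under `H_P`, with the normalizing factor absorbed into
the two diagonal parameters. -/
lemma mem_sorbit_groupP {v : Fin 3 → ℝ} (hv : v ∈ sphere2) (w : Fin 3 → ℝ) :
    w ∈ sorbit groupP v ↔ w ∈ sphere2 ∧ ∃ p q b : ℝ, 0 < p ∧ 0 < q ∧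
      w 0 = p * (v 0 + b * v 1) ∧ w 1 = p * v 1 ∧ w 2 = q * v 2 := by
  constructor
  · rintro ⟨A, ⟨a, b, c, rfl⟩, rfl⟩
    set A : Matrix (Fin 3) (Fin 3) ℝ :=
      !![Real.exp a, b * Real.exp a, 0; 0, Real.exp a, 0; 0, 0, Real.exp c] with hA
    have h0 : A.mulVec v 0 = Real.exp a * (v 0 + b * v 1) := by
      simp [hA, Matrix.mulVec, dotProduct, Fin.sum_univ_three]; ring
    have h1 : A.mulVec v 1 = Real.exp a * v 1 := by
      simp [hA, Matrix.mulVec, dotProduct, Fin.sum_univ_three]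
    have h2 : A.mulVec v 2 = Real.exp c * v 2 := by
      simp [hA, Matrix.mulVec, dotProduct, Fin.sum_univ_three]
    have hs : 0 < ∑ i, A.mulVec v i ^ 2 := by
      refine (Finset.sum_nonneg fun i _ => sq_nonneg _).lt_of_ne' fun h => ?_
      have hz := sum_sq_eq_zero h
      have z1 : v 1 = 0 := by
        simpa [hz, (Real.exp_pos a).ne'] using h1.symm
      have z0 : v 0 = 0 := by
        simpa [hz, z1, (Real.exp_pos a).ne'] using h0.symm
      have z2 : v 2 = 0 := by
        simpa [hz, (Real.exp_pos c).ne'] using h2.symm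
      simp [mem_sphere2, z0, z1, z2] at hv
    have hr := Real.sqrt_pos.2 hs
    refine ⟨?_, (Real.sqrt (∑ i, A.mulVec v i ^ 2))⁻¹ * Real.exp a,
      (Real.sqrt (∑ i, A.mulVec v i ^ 2))⁻¹ * Real.exp c, b, by positivity, by positivity,
      ?_, ?_, ?_⟩
    · simp only [sphere2, projAct, Set.mem_ofPred_eq, Pi.smul_apply, smul_eq_mul, mul_pow,
        ← Finset.mul_sum, inv_pow, Real.sq_sqrt hs.le]
      exact inv_mul_cancel₀ hs.ne'
    · simp only [projAct, Pi.smul_apply, smul_eq_mul, h0, mul_assoc]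
    · simp only [projAct, Pi.smul_apply, smul_eq_mul, h1, mul_assoc]
    · simp only [projAct, Pi.smul_apply, smul_eq_mul, h2, mul_assoc]
  · rintro ⟨hw, p, q, b, hp, hq, h0, h1, h2⟩
    refine ⟨_, ⟨Real.log p, b, Real.log q, rfl⟩, ?_⟩
    have hmul : Matrix.mulVec !![Real.exp (Real.log p), b * Real.exp (Real.log p), 0;
        0, Real.exp (Real.log p), 0; 0, 0, Real.exp (Real.log q)] v = w := by
      rw [Real.exp_log hp, Real.exp_log hq]
      funext i
      fin_cases i
      · simp [Matrix.mulVec, dotProduct, Fin.sum_univ_three, h0]; ring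
      · simp [Matrix.mulVec, dotProduct, Fin.sum_univ_three, h1]
      · simp [Matrix.mulVec, dotProduct, Fin.sum_univ_three, h2]
    have hw' : ∑ i, w i ^ 2 = 1 := hw
    rw [projAct, hmul, hw', Real.sqrt_one, inv_one, one_smul]

lemma unitVec_mem_sphere2 (i : Fin 3) {ε : ℝ} (hε : ε = 1 ∨ ε = -1) :
    unitVec i ε ∈ sphere2 := by
  have := mul_self_eq_one_of_sign hε
  fin_cases i <;> simp [mem_sphere2, unitVec, pow_two, this]

lemma eq_unitVec_zero {v : Fin 3 → ℝ} (hv : v ∈ sphere2) (h1 : v 1 = 0) (h2 : v 2 = 0) {ε : ℝ}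
    (hε : ε = 1 ∨ ε = -1) (h : 0 < ε * v 0) : v = unitVec 0 ε := by
  have hs : v 0 ^ 2 = 1 := by simpa [mem_sphere2, h1, h2] using hv
  have h0 : v 0 = ε := by
    rcases hε with rfl | rfl <;>
      rcases eq_or_eq_neg_of_sq_eq_sq _ 1 (hs.trans (one_pow 2).symm) with h' | h' <;> linarith
  funext i
  fin_cases i <;> simp [unitVec, h0, h1, h2]

lemma eq_unitVec_two {v : Fin 3 → ℝ} (hv : v ∈ sphere2) (h0 : v 0 = 0) (h1 : v 1 = 0) {ε : ℝ}
    (hε : ε = 1 ∨ ε = -1) (h : 0 < ε * v 2) : v = unitVec 2 ε := by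
  have hs : v 2 ^ 2 = 1 := by simpa [mem_sphere2, h0, h1] using hv
  have h2 : v 2 = ε := by
    rcases hε with rfl | rfl <;>
      rcases eq_or_eq_neg_of_sq_eq_sq _ 1 (hs.trans (one_pow 2).symm) with h' | h' <;> linarith
  funext i
  fin_cases i <;> simp [unitVec, h0, h1, h2]

lemma sorbit_unitVec_zero {ε : ℝ} (hε : ε = 1 ∨ ε = -1) :
    sorbit groupP (unitVec 0 ε) = {unitVec 0 ε} := by
  have hv := unitVec_mem_sphere2 0 hε
  ext w
  rw [mem_sorbit_groupP hv, Set.mem_singleton_iff]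
  constructor
  · rintro ⟨hw, p, q, b, hp, hq, h0, h1, h2⟩
    simp only [unitVec, if_true, one_ne_zero, if_false, Fin.reduceEq, mul_zero, add_zero]
      at h0 h1 h2
    refine eq_unitVec_zero hw h1 h2 hε ?_
    rw [h0, mul_left_comm, mul_self_eq_one_of_sign hε, mul_one]
    exact hp
  · rintro rfl
    exact ⟨hv, 1, 1, 0, by simp⟩

lemma sorbit_unitVec_two {ε : ℝ} (hε : ε = 1 ∨ ε = -1) :
    sorbit groupP (unitVec 2 ε) = {unitVec 2 ε} := by
  have hv := unitVec_mem_sphere2 2 hε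
  ext w
  rw [mem_sorbit_groupP hv, Set.mem_singleton_iff]
  constructor
  · rintro ⟨hw, p, q, b, hp, hq, h0, h1, h2⟩
    simp only [unitVec, if_true, if_false, Fin.reduceEq, mul_zero, add_zero] at h0 h1 h2
    refine eq_unitVec_two hw h0 h1 hε ?_
    rw [h2, mul_left_comm, mul_self_eq_one_of_sign hε, mul_one]
    exact hq
  · rintro rfl
    exact ⟨hv, 1, 1, 0, by simp⟩

lemma sorbit_arc {ε δ : ℝ} {v : Fin 3 → ℝ} (hv : v ∈ sphere2) (h1 : v 1 = 0)
    (h0 : 0 < ε * v 0) (h2 : 0 < δ * v 2) :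
    sorbit groupP v = {v ∈ sphere2 | v 1 = 0 ∧ 0 < ε * v 0 ∧ 0 < δ * v 2} := by
  have n0 : v 0 ≠ 0 := right_ne_zero_of_mul h0.ne'
  have n2 : v 2 ≠ 0 := right_ne_zero_of_mul h2.ne'
  ext w
  rw [mem_sorbit_groupP hv]
  refine and_congr_right fun _ => ⟨?_, ?_⟩
  · rintro ⟨p, q, b, hp, hq, e0, e1, e2⟩
    rw [e0, e1, e2, h1, mul_zero, mul_zero, add_zero, mul_left_comm, mul_left_comm δ]
    exact ⟨rfl, mul_pos hp h0, mul_pos hq h2⟩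
  · rintro ⟨w1, w0, w2⟩
    refine ⟨w 0 / v 0, w 2 / v 2, 0, div_pos_of_mul_pos w0 h0, div_pos_of_mul_pos w2 h2, ?_, ?_, ?_⟩
    · field_simp; ring
    · simp [w1, h1]
    · field_simp

lemma sorbit_half_circle {ε : ℝ} {v : Fin 3 → ℝ} (hv : v ∈ sphere2) (h2 : v 2 = 0)
    (h1 : 0 < ε * v 1) :
    sorbit groupP v = {v ∈ sphere2 | v 2 = 0 ∧ 0 < ε * v 1} := by
  have n1 : v 1 ≠ 0 := right_ne_zero_of_mul h1.ne'
  ext w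
  rw [mem_sorbit_groupP hv]
  refine and_congr_right fun _ => ⟨?_, ?_⟩
  · rintro ⟨p, q, b, hp, hq, e0, e1, e2⟩
    rw [e1, e2, h2, mul_zero, mul_left_comm]
    exact ⟨rfl, mul_pos hp h1⟩
  · rintro ⟨w2, w1⟩
    have m1 : w 1 ≠ 0 := right_ne_zero_of_mul w1.ne'
    refine ⟨w 1 / v 1, 1, w 0 / w 1 - v 0 / v 1, div_pos_of_mul_pos w1 h1, one_pos, ?_, ?_, ?_⟩
    · field_simp; ring
    · field_simp
    · simp [w2, h2]

lemma sorbit_lune {ε δ : ℝ} {v : Fin 3 → ℝ} (hv : v ∈ sphere2)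
    (h1 : 0 < ε * v 1) (h2 : 0 < δ * v 2) :
    sorbit groupP v = {v ∈ sphere2 | 0 < ε * v 1 ∧ 0 < δ * v 2} := by
  have n1 : v 1 ≠ 0 := right_ne_zero_of_mul h1.ne'
  have n2 : v 2 ≠ 0 := right_ne_zero_of_mul h2.ne'
  ext w
  rw [mem_sorbit_groupP hv]
  refine and_congr_right fun _ => ⟨?_, ?_⟩
  · rintro ⟨p, q, b, hp, hq, e0, e1, e2⟩
    rw [e1, e2, mul_left_comm, mul_left_comm δ]
    exact ⟨mul_pos hp h1, mul_pos hq h2⟩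
  · rintro ⟨w1, w2⟩
    have m1 : w 1 ≠ 0 := right_ne_zero_of_mul w1.ne'
    refine ⟨w 1 / v 1, w 2 / v 2, w 0 / w 1 - v 0 / v 1, div_pos_of_mul_pos w1 h1,
      div_pos_of_mul_pos w2 h2, ?_, ?_, ?_⟩
    · field_simp; ring
    · field_simp
    · field_simp

/-- Case P of Appendix C: `H_P = {M(a,b,c)}` is a subgroup of `GL(3,ℝ)` with
`M(a,b,c)·M(a′,b′,c′) = M(a+a′, b+b′, c+c′)`, and its orbits on `S²` are exactly the four
points `±e₁, ±e₃`, the four arcs of the circle `{v₂ = 0}` minus those points, the two open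
half-circles of the circle `{v₃ = 0}` minus `±e₁`, and the four open lunes
`{ε v₂ > 0, δ v₃ > 0}`. -/
theorem stmt12 (M : ℝ → ℝ → ℝ → Matrix (Fin 3) (Fin 3) ℝ)
    (hM : ∀ a b c : ℝ, M a b c =
      !![Real.exp a, b * Real.exp a, 0; 0, Real.exp a, 0; 0, 0, Real.exp c])
    (H : Set (Matrix (Fin 3) (Fin 3) ℝ)) (hH : H = {A | ∃ a b c : ℝ, A = M a b c}) :
    (∀ a b c a' b' c' : ℝ, M a b c * M a' b' c' = M (a + a') (b + b') (c + c')) ∧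
    M 0 0 0 = 1 ∧
    ({S : Set (Fin 3 → ℝ) | ∃ v ∈ sphere2, S = sorbit H v} =
      {S | ∃ ε : ℝ, (ε = 1 ∨ ε = -1) ∧ (S = {unitVec 0 ε} ∨ S = {unitVec 2 ε})} ∪
      {S | ∃ ε δ : ℝ, (ε = 1 ∨ ε = -1) ∧ (δ = 1 ∨ δ = -1) ∧
        S = {v ∈ sphere2 | v 1 = 0 ∧ 0 < ε * v 0 ∧ 0 < δ * v 2}} ∪
      {S | ∃ ε : ℝ, (ε = 1 ∨ ε = -1) ∧
        S = {v ∈ sphere2 | v 2 = 0 ∧ 0 < ε * v 1}} ∪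
      {S | ∃ ε δ : ℝ, (ε = 1 ∨ ε = -1) ∧ (δ = 1 ∨ δ = -1) ∧
        S = {v ∈ sphere2 | 0 < ε * v 1 ∧ 0 < δ * v 2}}) := by
  obtain rfl : H = groupP := by simp only [hH, hM, groupP]
  refine ⟨fun a b c a' b' c' => ?_, ?_, ?_⟩
  · simp only [hM, Real.exp_add]
    ext i j
    fin_cases i <;> fin_cases j <;> simp [Matrix.mul_apply, Fin.sum_univ_three]
    ring
  · rw [hM]
    ext i j
    fin_cases i <;> fin_cases j <;> simp
  apply Set.Subset.antisymm
  · rintro S ⟨v, hv, rfl⟩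
    by_cases h1 : v 1 = 0
    · by_cases h2 : v 2 = 0
      · have h0 : v 0 ≠ 0 := fun h0 => by simp [mem_sphere2, h0, h1, h2] at hv
        obtain ⟨ε, hε, h⟩ := exists_sign h0
        refine Or.inl (Or.inl (Or.inl ⟨ε, hε, Or.inl ?_⟩))
        rw [eq_unitVec_zero hv h1 h2 hε h, sorbit_unitVec_zero hε]
      · obtain ⟨δ, hδ, h⟩ := exists_sign h2
        by_cases h0 : v 0 = 0
        · refine Or.inl (Or.inl (Or.inl ⟨δ, hδ, Or.inr ?_⟩))
          rw [eq_unitVec_two hv h0 h1 hδ h, sorbit_unitVec_two hδ]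
        · obtain ⟨ε, hε, h'⟩ := exists_sign h0
          exact Or.inl (Or.inl (Or.inr ⟨ε, δ, hε, hδ, sorbit_arc hv h1 h' h⟩))
    · obtain ⟨ε, hε, h⟩ := exists_sign h1
      by_cases h2 : v 2 = 0
      · exact Or.inl (Or.inr ⟨ε, hε, sorbit_half_circle hv h2 h⟩)
      · obtain ⟨δ, hδ, h'⟩ := exists_sign h2
        exact Or.inr ⟨ε, δ, hε, hδ, sorbit_lune hv h h'⟩
  · rintro S (((⟨ε, hε, rfl | rfl⟩ | ⟨ε, δ, hε, hδ, rfl⟩) | ⟨ε, hε, rfl⟩) | ⟨ε, δ, hε, hδ, rfl⟩)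
    · exact ⟨_, unitVec_mem_sphere2 0 hε, (sorbit_unitVec_zero hε).symm⟩
    · exact ⟨_, unitVec_mem_sphere2 2 hε, (sorbit_unitVec_two hε).symm⟩
    · have hε' := mul_self_eq_one_of_sign hε
      have hδ' := mul_self_eq_one_of_sign hδ
      refine ⟨![ε * (3 / 5), 0, δ * (4 / 5)], ?_, (sorbit_arc ?_ ?_ ?_ ?_).symm⟩ <;>
        simp [mem_sphere2] <;> nlinarith
    · have hv := unitVec_mem_sphere2 1 hε
      refine ⟨_, hv, (sorbit_half_circle hv ?_ ?_).symm⟩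
      · simp [unitVec]
      · rcases hε with rfl | rfl <;> simp [unitVec]
    · have hε' := mul_self_eq_one_of_sign hε
      have hδ' := mul_self_eq_one_of_sign hδ
      refine ⟨![0, ε * (3 / 5), δ * (4 / 5)], ?_, (sorbit_lune ?_ ?_ ?_).symm⟩ <;>
        simp [mem_sphere2] <;> nlinarith
end
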